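/- arXiv:1508.05891 — 13 statements merged into one kernel-verified Lean document; each statement's English description precedes it below -/
import Mathlib

section
/- Let n ≥ 2 and let w_1, …, w_k : Fin n → ℝ be weighting vectors (each non-increasing) that each sum to zero and that form a linearly independent set. Then for any functions r_1, …, r_k : Fin n → ℝ each summing to zero, the set of profiles f : Perm(Fin n) → ℝ satisfying T_{w_i}(f) = r_i for all 1 ≤ i ≤ k is infinite. -/
/-- The score function of the profile `f` under the weighting vector `w`, linear in `f`. -/
def positionalMap {n : ℕ} (w : Fin n → ℝ) :
    (Equiv.Perm (Fin n) → ℝ) →ₗ[ℝ] (Fin n → ℝ) where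
  toFun f c := ∑ σ : Equiv.Perm (Fin n), f σ * w (σ⁻¹ c)
  map_add' f g := by
    ext c
    simp [add_mul, Finset.sum_add_distrib]
  map_smul' t f := by
    ext c
    simp [Finset.mul_sum, mul_assoc]

theorem positionalMap_apply {n : ℕ} (w : Fin n → ℝ) (f : Equiv.Perm (Fin n) → ℝ) (c : Fin n) :
    positionalMap w f c = ∑ σ : Equiv.Perm (Fin n), f σ * w (σ⁻¹ c) :=
  rfl

theorem positionalMap_single {n : ℕ} (w : Fin n → ℝ) (σ : Equiv.Perm (Fin n)) (c : Fin n) :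
    positionalMap w (Pi.single σ 1) c = w (σ⁻¹ c) := by
  simp [positionalMap_apply, Pi.single_apply]

theorem exists_perm_map_pair {α : Type*} [DecidableEq α] {a b c d : α} (hab : a ≠ b)
    (hcd : c ≠ d) : ∃ σ : Equiv.Perm α, σ a = c ∧ σ b = d := by
  refine ⟨Equiv.swap (Equiv.swap a c b) d * Equiv.swap a c, ?_, by simp⟩
  have h : c ≠ Equiv.swap a c b := by
    intro h
    apply hab
    apply (Equiv.swap a c).injective
    rw [Equiv.swap_apply_left, ← h]
  simp [Equiv.swap_apply_of_ne_of_ne h hcd]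

/-- Two rankings that differ by exchanging positions `a` and `b`, taken with opposite signs,
transfer `w a - w b` points from `d` to `c`. -/
theorem exists_profile_transfer {n : ℕ} (a b c d : Fin n) :
    ∃ f : Equiv.Perm (Fin n) → ℝ, ∀ w : Fin n → ℝ,
      positionalMap w f = (w a - w b) • (Pi.single c 1 - Pi.single d 1) := by
  by_cases hab : a = b
  · exact ⟨0, fun w => by simp [hab]⟩
  by_cases hcd : c = d
  · exact ⟨0, fun w => by simp [hcd]⟩
  obtain ⟨σ, rfl, rfl⟩ := exists_perm_map_pair hab hcd
  refine ⟨Pi.single σ 1 - Pi.single (σ * Equiv.swap a b) 1, fun w => ?_⟩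
  ext x
  obtain ⟨y, rfl⟩ := σ.surjective x
  rw [map_sub, Pi.sub_apply, positionalMap_single, positionalMap_single]
  simp only [mul_inv_rev, Equiv.Perm.mul_apply, Equiv.Perm.inv_def, Equiv.symm_apply_apply,
    Pi.smul_apply, Pi.sub_apply, Pi.single_apply, σ.injective.eq_iff, smul_eq_mul]
  rcases eq_or_ne y a with rfl | hya
  · simp [hab]
  rcases eq_or_ne y b with rfl | hyb
  · simp [hya]
  · simp [hya, hyb, Equiv.swap_apply_of_ne_of_ne hya hyb]

/-- A zero-sum `g` and a vector `u` give a profile whose score under each zero-sum `w` is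
`⟨w, u⟩ • g`. -/
theorem exists_profile_rank_one {n : ℕ} (hn : 0 < n) (u g : Fin n → ℝ) (hg : ∑ c, g c = 0) :
    ∃ f : Equiv.Perm (Fin n) → ℝ, ∀ w : Fin n → ℝ, ∑ c, w c = 0 →
      positionalMap w f = (∑ a, w a * u a) • g := by
  choose F hF using fun a b c : Fin n => exists_profile_transfer a b c ⟨0, hn⟩
  refine ⟨∑ a, ∑ b, ∑ c, ((n : ℝ)⁻¹ * u a * g c) • F a b c, fun w hw => ?_⟩
  have hn0 : (n : ℝ) ≠ 0 := by positivity
  have hgs : ∑ c, g c • (Pi.single c 1 - Pi.single ⟨0, hn⟩ 1 : Fin n → ℝ) = g := by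
    simp only [smul_sub, Finset.sum_sub_distrib]
    rw [← Finset.sum_smul, hg, zero_smul, sub_zero]
    ext x
    simp [Finset.sum_apply, Pi.single_apply]
  have hb (a : Fin n) : ∑ b, (n : ℝ)⁻¹ * u a * (w a - w b) = w a * u a := by
    rw [← Finset.mul_sum, Finset.sum_sub_distrib, hw]
    simp
    field_simp
  simp only [map_sum, map_smul, hF]
  calc
    _ = ∑ a, ∑ b, ((n : ℝ)⁻¹ * u a * (w a - w b)) •
        ∑ c, g c • (Pi.single c 1 - Pi.single ⟨0, hn⟩ 1 : Fin n → ℝ) := by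
      refine Finset.sum_congr rfl fun a _ => Finset.sum_congr rfl fun b _ => ?_
      rw [Finset.smul_sum]
      refine Finset.sum_congr rfl fun c _ => ?_
      rw [smul_smul, smul_smul]
      congr 1
      ring
    _ = _ := by
      rw [hgs]
      simp only [← Finset.sum_smul, hb]

theorem positionalMap_one {n : ℕ} (w : Fin n → ℝ) (hw : ∑ c, w c = 0) :
    positionalMap w 1 = 0 := by
  have hconst (c d : Fin n) : positionalMap w 1 c = positionalMap w 1 d := by
    simp only [positionalMap_apply, Pi.one_apply, one_mul]
    refine Fintype.sum_equiv (Equiv.mulLeft (Equiv.swap c d)) _ _ fun σ => ?_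
    simp
  have htotal : ∑ c, positionalMap w 1 c = 0 := by
    simp only [positionalMap_apply, Pi.one_apply, one_mul]
    rw [Finset.sum_comm]
    refine Finset.sum_eq_zero fun σ _ => ?_
    rw [Equiv.sum_comp σ⁻¹ w, hw]
  ext c
  have hn : (n : ℝ) ≠ 0 := by
    have := c.pos
    positivity
  rw [Finset.sum_congr rfl fun d _ => hconst d c] at htotal
  simpa [hn] using htotal

theorem LinearIndependent.exists_dual_vectors {n k : ℕ} {w : Fin k → Fin n → ℝ}
    (hw : LinearIndependent ℝ w) :
    ∃ u : Fin k → Fin n → ℝ, ∀ i j, ∑ a, w i a * u j a = if i = j then 1 else 0 := by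
  obtain ⟨G, hG⟩ := (Fintype.linearCombination ℝ w).exists_leftInverse_of_injective
    (LinearMap.ker_eq_bot.2 hw.fintypeLinearCombination_injective)
  refine ⟨fun j a => G (Pi.single a 1) j, fun i j => ?_⟩
  have h := congrFun (LinearMap.congr_fun hG (Pi.single i 1)) j
  simp only [LinearMap.comp_apply, Fintype.linearCombination_apply_single, one_smul,
    LinearMap.id_apply] at h
  have hs (a : Fin n) : (fun b => if a = b then (1 : ℝ) else 0) = Pi.single a 1 := by
    ext b
    simp [Pi.single_apply, eq_comm]
  rw [LinearMap.pi_apply_eq_sum_univ G (w i)] at h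
  simp only [hs] at h
  rw [Pi.single_apply] at h
  simpa [Finset.sum_apply, eq_comm] using h


/-- Let n ≥ 2 and let w_1, …, w_k : Fin n → ℝ be weighting vectors
(each non-increasing) that each sum to zero and that form a linearly independent set.
Then for any functions r_1, …, r_k : Fin n → ℝ each summing to zero, the set of
profiles f : Perm(Fin n) → ℝ satisfying T_{w_i}(f) = r_i for all i is infinite. -/
theorem positional_fibers_infinite (n k : ℕ) (hn : 2 ≤ n)
    (w : Fin k → Fin n → ℝ)
    (hw_mono : ∀ i, Antitone (w i))
    (hw_sum : ∀ i, ∑ c, w i c = 0)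
    (hw_li : LinearIndependent ℝ w)
    (r : Fin k → Fin n → ℝ)
    (hr : ∀ i, ∑ c, r i c = 0) :
    {f : Equiv.Perm (Fin n) → ℝ |
      ∀ i : Fin k,
        (fun c => ∑ σ : Equiv.Perm (Fin n), f σ * w i (σ⁻¹ c)) = r i}.Infinite := by
  obtain ⟨u, hu⟩ := hw_li.exists_dual_vectors
  choose F hF using fun j => exists_profile_rank_one (by omega : 0 < n) (u j) (r j) (hr j)
  have : Nonempty (Equiv.Perm (Fin n)) := ⟨1⟩
  refine Set.infinite_of_injective_forall_mem (f := fun t : ℝ => ∑ j, F j + t • 1)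
    (fun s t hst => ?_) fun t i => ?_
  · simpa using congrFun hst 1
  · change positionalMap (w i) (∑ j, F j + t • 1) = r i
    rw [map_add, map_smul, positionalMap_one _ (hw_sum i), map_sum]
    simp [hF _ _ (hw_sum i), hu]
end

section
/- Let n ≥ 2 and let w, w' : Fin n → ℝ be weighting vectors (non-increasing). Then the following are equivalent: (1) for every nonnegative profile p : Perm(Fin n) → ℝ and all candidates c, d, one has T_w(p)(c) ≥ T_w(p)(d) if and only if T_{w'}(p)(c) ≥ T_{w'}(p)(d); (2) there exist real numbers α > 0 and α' such that w' = α·w + α'·𝟏, where 𝟏 is the all-ones function on Fin n. -/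
/-- A permutation can be chosen with prescribed values at two distinct points. -/
theorem exists_perm_apply_eq_apply_eq {α : Type*} [DecidableEq α] {c d i j : α}
    (hcd : c ≠ d) (hij : i ≠ j) : ∃ τ : Equiv.Perm α, τ c = i ∧ τ d = j := by
  refine ⟨Equiv.swap (Equiv.swap c i d) j * Equiv.swap c i, ?_, ?_⟩
  · have hne : i ≠ Equiv.swap c i d := by
      intro h
      have h' : Equiv.swap c i c = Equiv.swap c i d := by
        rw [Equiv.swap_apply_left]
        exact h
      exact hcd ((Equiv.swap c i).injective h')
    rw [Equiv.Perm.mul_apply, Equiv.swap_apply_left, Equiv.swap_apply_of_ne_of_ne hne hij]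
  · rw [Equiv.Perm.mul_apply, Equiv.swap_apply_left]

/-- Testing equality of ordinal rankings on a profile supported on two votes. -/
theorem two_vote_comparison {n : ℕ} {w w' : Fin n → ℝ}
    (h : ∀ p : Equiv.Perm (Fin n) → ℝ, (∀ σ, 0 ≤ p σ) →
      ∀ c d : Fin n,
        ((∑ σ : Equiv.Perm (Fin n), p σ * w (σ⁻¹ d)) ≤
            ∑ σ : Equiv.Perm (Fin n), p σ * w (σ⁻¹ c) ↔
          (∑ σ : Equiv.Perm (Fin n), p σ * w' (σ⁻¹ d)) ≤
            ∑ σ : Equiv.Perm (Fin n), p σ * w' (σ⁻¹ c)))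
    {i j k l : Fin n} (hij : i ≠ j) (hkl : k ≠ l) {x y : ℝ} (hx : 0 ≤ x) (hy : 0 ≤ y) :
    x * w j + y * w l ≤ x * w i + y * w k ↔
      x * w' j + y * w' l ≤ x * w' i + y * w' k := by
  obtain ⟨σ, hσi, hσj⟩ := exists_perm_apply_eq_apply_eq hij hij
  obtain ⟨τ, hτi, hτj⟩ := exists_perm_apply_eq_apply_eq hij hkl
  have key := h (fun ρ => (if ρ = σ⁻¹ then x else 0) + (if ρ = τ⁻¹ then y else 0))
    (fun ρ => add_nonneg (by split_ifs <;> simp [hx]) (by split_ifs <;> simp [hy])) i j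
  simpa only [add_mul, Finset.sum_add_distrib, ite_mul, zero_mul, Finset.sum_ite_eq',
    Finset.mem_univ, if_true, inv_inv, hσi, hσj, hτi, hτj] using key

/-- For non-increasing weighting vectors w, w' on Fin n (n ≥ 2), the
positional procedures T_w and T_{w'} give the same ordinal rankings on every
nonnegative profile if and only if w' = α·w + α'·𝟏 with α > 0. -/
theorem same_ordinal_rankings_iff_equivalent (n : ℕ) (hn : 2 ≤ n)
    (w w' : Fin n → ℝ) (hw : Antitone w) (hw' : Antitone w') :
    (∀ p : Equiv.Perm (Fin n) → ℝ, (∀ σ, 0 ≤ p σ) →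
      ∀ c d : Fin n,
        ((∑ σ : Equiv.Perm (Fin n), p σ * w (σ⁻¹ d)) ≤
            ∑ σ : Equiv.Perm (Fin n), p σ * w (σ⁻¹ c) ↔
          (∑ σ : Equiv.Perm (Fin n), p σ * w' (σ⁻¹ d)) ≤
            ∑ σ : Equiv.Perm (Fin n), p σ * w' (σ⁻¹ c)))
    ↔ ∃ α α' : ℝ, 0 < α ∧ ∀ c : Fin n, w' c = α * w c + α' := by
  constructor
  · intro h
    have single {i j : Fin n} (hij : i ≠ j) : w j ≤ w i ↔ w' j ≤ w' i := by
      simpa using two_vote_comparison h hij hij zero_le_one le_rfl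
    let f : Fin n := ⟨0, by omega⟩
    let m : Fin n := ⟨n - 1, by omega⟩
    have hfm : f ≠ m := by
      simp only [f, m, ne_eq, Fin.mk.injEq]
      omega
    have hf (i : Fin n) : f ≤ i := Nat.zero_le _
    have hm (i : Fin n) : i ≤ m := Nat.le_sub_one_of_lt i.isLt
    rcases (hw (hf m)).eq_or_lt with heq | hlt
    · have heq' : w' f ≤ w' m := (single hfm.symm).1 heq.ge
      refine ⟨1, w' m - w m, one_pos, fun i => ?_⟩
      linarith [hw (hf i), hw (hm i), hw' (hf i), hw' (hm i)]
    · have hlt' : w' m < w' f := lt_of_not_ge fun hle =>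
        hlt.not_ge ((single hfm.symm).2 hle)
      have ha : 0 < w f - w m := sub_pos.2 hlt
      refine ⟨(w' f - w' m) / (w f - w m),
        w' m - (w' f - w' m) / (w f - w m) * w m, div_pos (sub_pos.2 hlt') ha, fun i => ?_⟩
      rcases eq_or_ne i m with rfl | him
      · ring
      · have hb : 0 ≤ w i - w m := sub_nonneg.2 (hw (hm i))
        have h₁ := (two_vote_comparison h him hfm.symm ha.le hb).1 (by linarith)
        have h₂ := (two_vote_comparison h him.symm hfm ha.le hb).1 (by linarith)
        field_simp
        linarith
  · rintro ⟨α, α', hα, hww⟩ p - c d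
    have hT (c : Fin n) : ∑ σ : Equiv.Perm (Fin n), p σ * w' (σ⁻¹ c) =
        α * (∑ σ : Equiv.Perm (Fin n), p σ * w (σ⁻¹ c)) + α' * ∑ σ, p σ := by
      rw [Finset.mul_sum, Finset.mul_sum, ← Finset.sum_add_distrib]
      exact Finset.sum_congr rfl fun σ _ => by rw [hww]; ring
    rw [hT, hT, add_le_add_iff_right, mul_le_mul_iff_right₀ hα]
end

section
/- Let n ≥ 2. For every profile p : Perm(Fin n) → ℝ and every ranking τ ∈ Perm(Fin n), the Kemeny score satisfies K(p)(τ) = Σ_{σ} p(σ)·(C(n,2) − d(σ,τ)) = Σ_{(i,j), i ≠ j} ⟨p, a_{ij}⟩·a_{ij}(τ), where the last sum is over all ordered pairs of distinct candidates. In other words, K = P* ∘ P, where P is the pairs map and P* its adjoint. -/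
/-- The indicator `a_{ij}` of rankings placing candidate `i` above candidate `j`:
`a i j σ = 1` if `σ⁻¹ i < σ⁻¹ j` and `0` otherwise. -/
def pairIndicator (n : ℕ) (i j : Fin n) (σ : Equiv.Perm (Fin n)) : ℝ :=
  if σ⁻¹ i < σ⁻¹ j then 1 else 0

/-- The Kendall tau distance between two rankings: the number of unordered pairs of
distinct candidates on which they disagree about the relative order. -/
def kendallTau (n : ℕ) (σ τ : Equiv.Perm (Fin n)) : ℕ :=
  (Finset.univ.filter fun ij : Fin n × Fin n =>
    ij.1 < ij.2 ∧ ¬((σ⁻¹ ij.1 < σ⁻¹ ij.2) ↔ (τ⁻¹ ij.1 < τ⁻¹ ij.2))).card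

theorem card_filter_fst_lt_snd (n : ℕ) :
    (Finset.univ.filter fun ij : Fin n × Fin n => ij.1 < ij.2).card = n.choose 2 := by
  rw [Finset.card_filter, Fintype.sum_prod_type_right]
  simp only [← Finset.card_filter]
  have card_lt (j : Fin n) : (Finset.univ.filter fun i : Fin n => i < j).card = j := by
    rw [Finset.filter_gt_eq_Iio, Fin.card_Iio]
  simp only [card_lt]
  rw [Fin.sum_univ_eq_sum_range (fun i => i), Finset.sum_range_id, Nat.choose_two_right]

theorem sum_filter_ne_eq_sum_filter_lt {α M : Type*} [Fintype α] [LinearOrder α]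
    [AddCommMonoid M] (f : α × α → M) :
    ∑ ij ∈ Finset.univ.filter (fun ij : α × α => ij.1 ≠ ij.2), f ij =
      ∑ ij ∈ Finset.univ.filter (fun ij : α × α => ij.1 < ij.2), (f ij + f ij.swap) := by
  have sum_swap : ∑ ij ∈ Finset.univ.filter (fun ij : α × α => ij.1 < ij.2), f ij.swap =
      ∑ ij ∈ Finset.univ.filter (fun ij : α × α => ij.2 < ij.1), f ij :=
    Finset.sum_equiv (Equiv.prodComm α α) (by simp) (by simp)
  rw [Finset.sum_add_distrib, sum_swap, ← Finset.sum_union]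
  · congr 1
    ext ij
    simp
  · exact Finset.disjoint_filter.2 fun _ _ h => h.asymm

/-- Of a pair and its swap, the rankings `σ` and `τ` jointly support exactly one if they agree on
the pair and none otherwise. -/
theorem pairIndicator_mul_add_swap (n : ℕ) (σ τ : Equiv.Perm (Fin n)) {i j : Fin n}
    (hij : i ≠ j) :
    pairIndicator n i j σ * pairIndicator n i j τ +
        pairIndicator n j i σ * pairIndicator n j i τ =
      1 - if ¬((σ⁻¹ i < σ⁻¹ j) ↔ (τ⁻¹ i < τ⁻¹ j)) then 1 else 0 := by
  have lt_swap (ρ : Equiv.Perm (Fin n)) : ρ⁻¹ j < ρ⁻¹ i ↔ ¬ρ⁻¹ i < ρ⁻¹ j := by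
    rw [not_lt, lt_iff_le_and_ne, and_iff_left (ρ⁻¹.injective.ne hij.symm)]
  simp only [pairIndicator, lt_swap]
  by_cases hσ : σ⁻¹ i < σ⁻¹ j <;> by_cases hτ : τ⁻¹ i < τ⁻¹ j <;>
    simp only [hσ, hτ] <;> norm_num

theorem choose_two_sub_kendallTau (n : ℕ) (σ τ : Equiv.Perm (Fin n)) :
    (n.choose 2 : ℝ) - (kendallTau n σ τ : ℝ) =
      ∑ ij ∈ Finset.univ.filter (fun ij : Fin n × Fin n => ij.1 ≠ ij.2),
        pairIndicator n ij.1 ij.2 σ * pairIndicator n ij.1 ij.2 τ := by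
  simp only [sum_filter_ne_eq_sum_filter_lt, Prod.fst_swap, Prod.snd_swap]
  rw [Finset.sum_congr rfl fun ij hij =>
    pairIndicator_mul_add_swap n σ τ (Finset.mem_filter.1 hij).2.ne, Finset.sum_sub_distrib,
    Finset.sum_boole, Finset.filter_filter, Finset.sum_const, card_filter_fst_lt_snd,
    nsmul_one, kendallTau]

/-- For every profile p and ranking τ, the Kemeny score
K(p)(τ) = Σ_σ p(σ)·(C(n,2) − d(σ,τ)) equals Σ_{i≠j} ⟨p, a_{ij}⟩·a_{ij}(τ);
that is, K = P* ∘ P where P is the pairs map. -/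
theorem kemeny_eq_pairs_adjoint_comp (n : ℕ) (hn : 2 ≤ n)
    (p : Equiv.Perm (Fin n) → ℝ) (τ : Equiv.Perm (Fin n)) :
    ∑ σ : Equiv.Perm (Fin n), p σ * ((n.choose 2 : ℝ) - (kendallTau n σ τ : ℝ)) =
      ∑ ij ∈ Finset.univ.filter (fun ij : Fin n × Fin n => ij.1 ≠ ij.2),
        (∑ σ : Equiv.Perm (Fin n), p σ * pairIndicator n ij.1 ij.2 σ) *
          pairIndicator n ij.1 ij.2 τ := by
  simp only [choose_two_sub_kendallTau, Finset.mul_sum, Finset.sum_mul, mul_assoc]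
  exact Finset.sum_comm
end

section
/- Let n ≥ 2. The pairs map P : ℝ^{Perm(Fin n)} → ℝ^{{(i,j) : i ≠ j}}, defined by P(p)(i,j) = ⟨p, a_{ij}⟩, has rank (n² − n + 2)/2 = 1 + (n−1) + (n−1)(n−2)/2. -/
/-- The pairs map `P`, sending a profile `p` to the function on ordered pairs of
distinct candidates defined by `P(p)(i,j) = ⟨p, a_{ij}⟩`. -/
noncomputable def pairsMap (n : ℕ) :
    (Equiv.Perm (Fin n) → ℝ) →ₗ[ℝ] ({ij : Fin n × Fin n // ij.1 ≠ ij.2} → ℝ) where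
  toFun p := fun ij => ∑ σ : Equiv.Perm (Fin n), p σ * pairIndicator n ij.1.1 ij.1.2 σ
  map_add' p q := by
    funext ij
    simp [add_mul, Finset.sum_add_distrib]
  map_smul' a p := by
    funext ij
    simp [Finset.mul_sum, mul_assoc]

/-- Interchanging the two lowest elements of `Fin n` only affects the comparison between them. -/
lemma swap_lowest_lt_iff {n : ℕ} {z o x y : Fin n} (hz : z.val = 0) (ho : o.val = 1)
    (hne : ¬(x = z ∧ y = o)) (hne' : ¬(x = o ∧ y = z)) :
    Equiv.swap z o x < Equiv.swap z o y ↔ x < y := by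
  simp only [Equiv.swap_apply_def]
  split_ifs <;> simp only [Fin.ext_iff, Fin.lt_def] at * <;> omega

/-- Some permutation sends `i` to `z` and `j` to `o`, provided both pairs are distinct. -/
lemma exists_perm_apply_pair {α : Type*} [DecidableEq α] {i j z o : α} (hij : i ≠ j)
    (hzo : z ≠ o) : ∃ τ : Equiv.Perm α, τ i = z ∧ τ j = o := by
  refine ⟨Equiv.swap (Equiv.swap i z j) o * Equiv.swap i z, ?_, by simp⟩
  have h : z ≠ Equiv.swap i z j := fun h => hij <| (Equiv.swap i z).injective <| by
    rw [Equiv.swap_apply_left]; exact h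
  simp [Equiv.swap_apply_of_ne_of_ne h hzo]

/-- Two rankings that differ by exchanging `i` and `j` in the top two positions have the same
indicators, except for the pair `i`, `j` itself. -/
lemma exists_pairIndicator_sub {n : ℕ} (hn : 2 ≤ n) {i j : Fin n} (hij : i < j) :
    ∃ σ σ' : Equiv.Perm (Fin n), ∀ a b : Fin n, a < b →
      pairIndicator n a b σ - pairIndicator n a b σ' = if a = i ∧ b = j then 1 else 0 := by
  let z : Fin n := ⟨0, by omega⟩
  let o : Fin n := ⟨1, by omega⟩
  have hzo : z ≠ o := by simp [z, o]
  have hlt : z < o := by simp [z, o]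
  obtain ⟨τ, hi, hj⟩ := exists_perm_apply_pair hij.ne hzo
  refine ⟨τ⁻¹, (Equiv.swap z o * τ)⁻¹, fun a b hab => ?_⟩
  simp only [pairIndicator, inv_inv, Equiv.Perm.mul_apply]
  by_cases h : a = i ∧ b = j
  · obtain ⟨rfl, rfl⟩ := h
    simp [hi, hj, hlt, hlt.le]
  · have h1 : ¬(τ a = z ∧ τ b = o) := by
      rwa [← hi, ← hj, τ.injective.eq_iff, τ.injective.eq_iff]
    have h2 : ¬(τ a = o ∧ τ b = z) := by
      rw [← hi, ← hj, τ.injective.eq_iff, τ.injective.eq_iff]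
      rintro ⟨rfl, rfl⟩
      exact hab.asymm hij
    simp [swap_lowest_lt_iff (z := z) (o := o) rfl rfl h1 h2, h]

/-- The indicators of the two orders of a pair of distinct candidates add up to `1`. -/
lemma pairIndicator_add_swap {n : ℕ} {i j : Fin n} (hij : i ≠ j) (σ : Equiv.Perm (Fin n)) :
    pairIndicator n i j σ + pairIndicator n j i σ = 1 := by
  have hne : σ⁻¹ i ≠ σ⁻¹ j := (σ⁻¹).injective.ne hij
  rcases hne.lt_or_gt with h | h <;>
    simp only [pairIndicator, h, h.asymm, if_true, if_false, add_zero, zero_add]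

/-- The total weight of a profile together with its values on the pairs `i < j`. -/
noncomputable def totalAndPairsMap (n : ℕ) :
    (Equiv.Perm (Fin n) → ℝ) →ₗ[ℝ] (Option {x : Fin n × Fin n // x.1 < x.2} → ℝ) :=
  LinearMap.pi fun
    | none => ∑ σ, LinearMap.proj σ
    | some x => LinearMap.proj ⟨x.1, x.2.ne⟩ ∘ₗ pairsMap n

lemma totalAndPairsMap_none {n : ℕ} (p : Equiv.Perm (Fin n) → ℝ) :
    totalAndPairsMap n p none = ∑ σ, p σ := by
  simp [totalAndPairsMap]

lemma totalAndPairsMap_some {n : ℕ} (p : Equiv.Perm (Fin n) → ℝ)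
    (x : {x : Fin n × Fin n // x.1 < x.2}) :
    totalAndPairsMap n p (some x) = pairsMap n p ⟨x.1, x.2.ne⟩ := by
  simp [totalAndPairsMap]

lemma pairsMap_single {n : ℕ} (σ : Equiv.Perm (Fin n))
    (x : {ij : Fin n × Fin n // ij.1 ≠ ij.2}) :
    pairsMap n (Pi.single σ 1) x = pairIndicator n x.1.1 x.1.2 σ := by
  simp [pairsMap, Pi.single_apply]

lemma pairsMap_add_swap {n : ℕ} (p : Equiv.Perm (Fin n) → ℝ) {i j : Fin n} (hij : i ≠ j) :
    pairsMap n p ⟨(i, j), hij⟩ + pairsMap n p ⟨(j, i), hij.symm⟩ = ∑ σ, p σ := by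
  simp only [pairsMap, LinearMap.coe_mk, AddHom.coe_mk, ← Finset.sum_add_distrib, ← mul_add,
    pairIndicator_add_swap hij, mul_one]

lemma ker_totalAndPairsMap {n : ℕ} (hn : 2 ≤ n) :
    LinearMap.ker (totalAndPairsMap n) = LinearMap.ker (pairsMap n) := by
  ext p
  simp only [LinearMap.mem_ker]
  constructor
  · intro h
    have h0 := congrFun h none
    rw [totalAndPairsMap_none] at h0
    have hlt (i j : Fin n) (hij : i < j) : pairsMap n p ⟨(i, j), hij.ne⟩ = 0 := by
      rw [← totalAndPairsMap_some p ⟨(i, j), hij⟩, h, Pi.zero_apply]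
    funext ⟨⟨i, j⟩, hij⟩
    rcases (show i ≠ j from hij).lt_or_gt with h' | h'
    · exact hlt i j h'
    · have := pairsMap_add_swap p h'.ne
      rw [hlt j i h', h0] at this
      simpa using this
  · intro h
    funext x
    cases x with
    | none =>
      have hne : (⟨0, by omega⟩ : Fin n) ≠ ⟨1, by omega⟩ := by simp
      rw [totalAndPairsMap_none, ← pairsMap_add_swap p hne, h]
      simp
    | some x => rw [totalAndPairsMap_some, h, Pi.zero_apply, Pi.zero_apply]

lemma range_totalAndPairsMap {n : ℕ} (hn : 2 ≤ n) :
    LinearMap.range (totalAndPairsMap n) = ⊤ := by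
  have hsome (x : {x : Fin n × Fin n // x.1 < x.2}) :
      Pi.single (some x) 1 ∈ LinearMap.range (totalAndPairsMap n) := by
    obtain ⟨σ, σ', h⟩ := exists_pairIndicator_sub hn x.2
    refine ⟨Pi.single σ 1 - Pi.single σ' 1, ?_⟩
    funext y
    cases y with
    | none => simp [totalAndPairsMap_none]
    | some y =>
      rw [totalAndPairsMap_some, map_sub, Pi.sub_apply, pairsMap_single, pairsMap_single,
        h _ _ y.2]
      simp [Pi.single_apply, Subtype.ext_iff, Prod.ext_iff]
  have hnone : Pi.single none 1 ∈ LinearMap.range (totalAndPairsMap n) := by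
    have h : (Pi.single none 1 : Option {x : Fin n × Fin n // x.1 < x.2} → ℝ) =
        totalAndPairsMap n (Pi.single 1 1) -
          ∑ x, totalAndPairsMap n (Pi.single 1 1) (some x) • Pi.single (some x) 1 := by
      funext y
      cases y with
      | none => simp [totalAndPairsMap_none]
      | some y => simp [Finset.sum_apply, Pi.single_apply]
    rw [h]
    exact Submodule.sub_mem _ ⟨_, rfl⟩
      (Submodule.sum_mem _ fun x _ => Submodule.smul_mem _ _ (hsome x))
  rw [eq_top_iff, ← (Pi.basisFun ℝ _).span_eq, Submodule.span_le]
  rintro _ ⟨x, rfl⟩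
  rw [Pi.basisFun_apply]
  cases x with
  | none => exact hnone
  | some x => exact hsome x

lemma card_lt_pairs (n : ℕ) :
    Fintype.card {x : Fin n × Fin n // x.1 < x.2} = n * (n - 1) / 2 := by
  rw [Fintype.card_subtype, Finset.card_filter, Fintype.sum_prod_type_right]
  simp only [← Finset.card_filter, Finset.filter_gt_eq_Iio, Fin.card_Iio]
  rw [Fin.sum_univ_eq_sum_range (fun i => i), Finset.sum_range_id]

/-- The pairs map has rank (n² − n + 2)/2 = 1 + (n−1) + (n−1)(n−2)/2. -/
theorem pairsMap_rank (n : ℕ) (hn : 2 ≤ n) :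
    Module.finrank ℝ (LinearMap.range (pairsMap n)) = (n ^ 2 - n + 2) / 2 ∧
    (n ^ 2 - n + 2) / 2 = 1 + (n - 1) + (n - 1) * (n - 2) / 2 := by
  constructor
  · have h1 := (pairsMap n).finrank_range_add_finrank_ker
    have h2 := (totalAndPairsMap n).finrank_range_add_finrank_ker
    rw [ker_totalAndPairsMap hn, range_totalAndPairsMap hn, finrank_top,
      Module.finrank_fintype_fun_eq_card, Fintype.card_option, card_lt_pairs] at h2
    have h3 : n ^ 2 - n = n * (n - 1) := by rw [Nat.mul_sub, sq, mul_one]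
    omega
  · obtain ⟨m, rfl⟩ := Nat.exists_eq_add_of_le' hn
    have h : (m + 2) ^ 2 - (m + 2) + 2 = 2 * (1 + (m + 1)) + (m + 1) * m := by
      have h' : (m + 2) ^ 2 = m * m + 3 * m + 2 + (m + 2) := by ring
      rw [h', Nat.add_sub_cancel]
      ring
    rw [h]
    simp
    omega
end

section
/- Let n ≥ 3 and let K : ℝ^{Perm(Fin n)} → ℝ^{Perm(Fin n)} be the Kemeny operator K(p)(τ) = Σ_{(i,j), i≠j} ⟨p, a_{ij}⟩·a_{ij}(τ). Then K is self-adjoint, and its eigenvalues are exactly κ₀ = (n!/2)·C(n,2), κ₁ = (n+1)!/6, κ₂ = n!/6, and 0, with eigenspaces of dimensions 1, n−1, (n−1)(n−2)/2, and n! − (n² − n + 2)/2, respectively. -/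
/-- The Kemeny operator `K(p)(τ) = Σ_{(i,j), i≠j} ⟨p, a_{ij}⟩·a_{ij}(τ)`. -/
noncomputable def kemenyOp (n : ℕ) :
    (Equiv.Perm (Fin n) → ℝ) →ₗ[ℝ] (Equiv.Perm (Fin n) → ℝ) where
  toFun p := fun τ =>
    ∑ ij ∈ Finset.univ.filter (fun ij : Fin n × Fin n => ij.1 ≠ ij.2),
      (∑ σ : Equiv.Perm (Fin n), p σ * pairIndicator n ij.1 ij.2 σ) *
        pairIndicator n ij.1 ij.2 τ
  map_add' p q := by
    funext τ
    simp [add_mul, Finset.sum_add_distrib]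
  map_smul' a p := by
    funext τ
    simp [Finset.mul_sum, Finset.sum_mul, mul_assoc]

/-- Two endomorphisms `f ∘ g` and `g ∘ f` have the same eigenvectors up to `g`, away from `0`. -/
theorem finrank_eigenspace_comp_le {V W : Type*} [AddCommGroup V] [Module ℝ V] [AddCommGroup W]
    [Module ℝ W] [FiniteDimensional ℝ W] (f : W →ₗ[ℝ] V) (g : V →ₗ[ℝ] W)
    {μ : ℝ} (hμ : μ ≠ 0) :
    Module.finrank ℝ (Module.End.eigenspace (f ∘ₗ g) μ) ≤
      Module.finrank ℝ (Module.End.eigenspace (g ∘ₗ f) μ) := by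
  have hmaps : ∀ v ∈ Module.End.eigenspace (f ∘ₗ g) μ,
      g v ∈ Module.End.eigenspace (g ∘ₗ f) μ := by
    intro v hv
    rw [Module.End.mem_eigenspace_iff] at hv ⊢
    simp only [LinearMap.comp_apply] at hv ⊢
    rw [hv, map_smul]
  refine LinearMap.finrank_le_finrank_of_injective (f := g.restrict hmaps) ?_
  rw [← LinearMap.ker_eq_bot, LinearMap.ker_eq_bot']
  rintro ⟨v, hv⟩ h
  have h0 : g v = 0 := congrArg Subtype.val h
  rw [Module.End.mem_eigenspace_iff, LinearMap.comp_apply, h0, map_zero] at hv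
  exact Subtype.ext ((smul_eq_zero.mp hv.symm).resolve_left hμ)

theorem finrank_eigenspace_comp_comm {V W : Type*} [AddCommGroup V] [Module ℝ V] [AddCommGroup W]
    [Module ℝ W] [FiniteDimensional ℝ V] [FiniteDimensional ℝ W] (f : W →ₗ[ℝ] V)
    (g : V →ₗ[ℝ] W) {μ : ℝ} (hμ : μ ≠ 0) :
    Module.finrank ℝ (Module.End.eigenspace (f ∘ₗ g) μ) =
      Module.finrank ℝ (Module.End.eigenspace (g ∘ₗ f) μ) :=
  (finrank_eigenspace_comp_le f g hμ).antisymm (finrank_eigenspace_comp_le g f hμ)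

theorem hasEigenvalue_iff_finrank_ne_zero {V : Type*} [AddCommGroup V] [Module ℝ V]
    [FiniteDimensional ℝ V] (f : Module.End ℝ V) (μ : ℝ) :
    Module.End.HasEigenvalue f μ ↔ Module.finrank ℝ (Module.End.eigenspace f μ) ≠ 0 := by
  rw [Module.End.hasEigenvalue_iff, Ne, Ne, Submodule.finrank_eq_zero]

/-- The sign of the comparison of candidates `i` and `j`: `1` if `i` is above `j`, `-1` if below,
and `0` if `i = j`. -/
def pairSign {n : ℕ} (i j : Fin n) (σ : Equiv.Perm (Fin n)) : ℝ :=
  pairIndicator n i j σ - pairIndicator n j i σ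

section PairSign

variable {n : ℕ}

theorem pairSign_antisymm (i j : Fin n) (σ : Equiv.Perm (Fin n)) :
    pairSign i j σ = -pairSign j i σ := by
  simp [pairSign]

@[simp]
theorem pairSign_self (i : Fin n) (σ : Equiv.Perm (Fin n)) : pairSign i i σ = 0 := by
  simp [pairSign]

theorem pairIndicator_eq (i j : Fin n) (σ : Equiv.Perm (Fin n)) :
    pairIndicator n i j σ = ((if i = j then 0 else 1) + pairSign i j σ) / 2 := by
  by_cases h : i = j
  · subst h
    simp [pairIndicator]
  · have h' : σ⁻¹ i ≠ σ⁻¹ j := fun e => h (σ⁻¹.injective e)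
    rw [if_neg h]
    unfold pairSign pairIndicator
    rcases lt_or_gt_of_ne h' with h1 | h1
    · rw [if_pos h1, if_neg h1.not_gt]
      norm_num
    · rw [if_pos h1, if_neg h1.not_gt]
      norm_num

theorem pairSign_mul_self {i j : Fin n} (h : i ≠ j) (σ : Equiv.Perm (Fin n)) :
    pairSign i j σ * pairSign i j σ = 1 := by
  have h' : σ⁻¹ i ≠ σ⁻¹ j := fun e => h (σ⁻¹.injective e)
  unfold pairSign pairIndicator
  rcases lt_or_gt_of_ne h' with h1 | h1
  · rw [if_pos h1, if_neg h1.not_gt]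
    norm_num
  · rw [if_pos h1, if_neg h1.not_gt]
    norm_num

theorem pairSign_cyclic {i j k : Fin n} (hij : i ≠ j) (hjk : j ≠ k) (hki : k ≠ i)
    (σ : Equiv.Perm (Fin n)) :
    pairSign i j σ * pairSign j k σ + pairSign j k σ * pairSign k i σ +
      pairSign k i σ * pairSign i j σ = -1 := by
  have h1 : σ⁻¹ i ≠ σ⁻¹ j := fun e => hij (σ⁻¹.injective e)
  have h2 : σ⁻¹ j ≠ σ⁻¹ k := fun e => hjk (σ⁻¹.injective e)
  have h3 : σ⁻¹ k ≠ σ⁻¹ i := fun e => hki (σ⁻¹.injective e)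
  unfold pairSign pairIndicator
  generalize σ⁻¹ i = a at *
  generalize σ⁻¹ j = b at *
  generalize σ⁻¹ k = c at *
  split_ifs <;> first | omega | norm_num

theorem pairSign_mul (π σ : Equiv.Perm (Fin n)) (i j : Fin n) :
    pairSign (π i) (π j) (π * σ) = pairSign i j σ := by
  simp [pairSign, pairIndicator, mul_inv_rev]

theorem sum_pairSign (i j : Fin n) : ∑ σ, pairSign i j σ = 0 := by
  have h := Equiv.sum_comp (Equiv.mulLeft (Equiv.swap i j)) (fun σ => pairSign j i σ)
  have h2 : ∀ σ, pairSign j i (Equiv.mulLeft (Equiv.swap i j) σ) = pairSign i j σ := by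
    intro σ
    simpa using pairSign_mul (Equiv.swap i j) σ i j
  simp only [h2] at h
  have h3 : ∑ σ, pairSign i j σ = -∑ σ, pairSign j i σ := by
    rw [← Finset.sum_neg_distrib]
    exact Finset.sum_congr rfl fun σ _ => pairSign_antisymm i j σ
  linarith

/-- The inner product of two comparison signs. -/
def signGram (i j k l : Fin n) : ℝ :=
  ∑ σ : Equiv.Perm (Fin n), pairSign i j σ * pairSign k l σ

theorem signGram_perm (π : Equiv.Perm (Fin n)) (i j k l : Fin n) :
    signGram (π i) (π j) (π k) (π l) = signGram i j k l := by
  unfold signGram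
  rw [← Equiv.sum_comp (Equiv.mulLeft π)]
  simp [pairSign_mul]

theorem signGram_antisymm_left (i j k l : Fin n) :
    signGram i j k l = -signGram j i k l := by
  unfold signGram
  rw [← Finset.sum_neg_distrib]
  refine Finset.sum_congr rfl fun σ _ => ?_
  rw [pairSign_antisymm i j]
  ring

theorem signGram_antisymm_right (i j k l : Fin n) :
    signGram i j k l = -signGram i j l k := by
  unfold signGram
  rw [← Finset.sum_neg_distrib]
  refine Finset.sum_congr rfl fun σ _ => ?_
  rw [pairSign_antisymm k l]
  ring

theorem signGram_self_left (i k l : Fin n) : signGram i i k l = 0 := by simp [signGram]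

theorem signGram_self_right (i j k : Fin n) : signGram i j k k = 0 := by simp [signGram]

theorem signGram_same {i j : Fin n} (h : i ≠ j) : signGram i j i j = n.factorial := by
  simp [signGram, pairSign_mul_self h, Fintype.card_perm]

theorem signGram_path {i j k : Fin n} (hij : i ≠ j) (hjk : j ≠ k) (hki : k ≠ i) :
    signGram i j j k = -(n.factorial / 3 : ℝ) := by
  let π : Equiv.Perm (Fin n) := Equiv.swap i j * Equiv.swap j k
  have hi : π i = j := by
    simp [π, Equiv.swap_apply_of_ne_of_ne hij hki.symm]
  have hj : π j = k := by
    simp [π, Equiv.swap_apply_of_ne_of_ne hki hjk.symm]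
  have hk : π k = i := by
    simp [π]
  have e1 := signGram_perm π i j j k
  have e2 := signGram_perm π j k k i
  rw [hi, hj, hk] at e1
  rw [hj, hk, hi] at e2
  have hsum : signGram i j j k + signGram j k k i + signGram k i i j = -(n.factorial : ℝ) := by
    unfold signGram
    rw [← Finset.sum_add_distrib, ← Finset.sum_add_distrib]
    simp [pairSign_cyclic hij hjk hki, Fintype.card_perm]
  linarith

theorem signGram_disjoint {i j k l : Fin n} (hik : i ≠ k) (hil : i ≠ l) (hjk : j ≠ k)
    (hjl : j ≠ l) : signGram i j k l = 0 := by
  have h := signGram_perm (Equiv.swap i j) i j k l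
  rw [Equiv.swap_apply_left, Equiv.swap_apply_right,
    Equiv.swap_apply_of_ne_of_ne hik.symm hjk.symm,
    Equiv.swap_apply_of_ne_of_ne hil.symm hjl.symm] at h
  have h2 := signGram_antisymm_left i j k l
  linarith

theorem signGram_eq (i j k l : Fin n) :
    signGram i j k l = n.factorial / 3 *
      ((if i = k then 1 else 0) + (if j = l then 1 else 0) - (if i = l then 1 else 0)
        - (if j = k then 1 else 0) + (if i = k then if j = l then 1 else 0 else 0)
        - (if i = l then if j = k then 1 else 0 else 0)) := by
  by_cases hij : i = j
  · subst hij
    rw [signGram_self_left]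
    split_ifs <;> simp
  by_cases hkl : k = l
  · subst hkl
    rw [signGram_self_right]
    split_ifs <;> simp
  by_cases hik : i = k
  · subst hik
    by_cases hjl : j = l
    · subst hjl
      rw [signGram_same hij]
      simp [hij, Ne.symm hij]
      ring
    · rw [signGram_antisymm_left, signGram_path (Ne.symm hij) hkl (Ne.symm hjl)]
      simp [hjl, hkl, Ne.symm hij]
  by_cases hjl : j = l
  · subst hjl
    rw [signGram_antisymm_right, signGram_path hij (Ne.symm hkl) (Ne.symm hik)]
    simp [hij, hik, Ne.symm hkl]
  by_cases hil : i = l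
  · subst hil
    by_cases hjk : j = k
    · subst hjk
      rw [signGram_antisymm_right, signGram_same hij]
      simp [hij, Ne.symm hij]
      ring
    · rw [signGram_antisymm_right, signGram_antisymm_left,
        signGram_path (Ne.symm hij) hik (Ne.symm hjk)]
      simp [hik, hjk, hjl]
  by_cases hjk : j = k
  · subst hjk
    rw [signGram_path hij hkl (Ne.symm hil)]
    simp [hij, hil, hkl]
  rw [signGram_disjoint hik hil hjk hjl]
  simp [hik, hil, hjk, hjl]

end PairSign

/-- Antisymmetric real `n × n` arrays. -/
def antisymmSubmodule (n : ℕ) : Submodule ℝ (Fin n → Fin n → ℝ) where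
  carrier := {A | ∀ i j, A i j = -A j i}
  add_mem' {A B} hA hB i j := by
    simp only [Pi.add_apply]
    rw [hA i j, hB i j]
    ring
  zero_mem' i j := by simp
  smul_mem' c A hA i j := by
    simp only [Pi.smul_apply, smul_eq_mul]
    rw [hA i j]
    ring

/-- An antisymmetric array is determined by its entries above the diagonal. -/
def antisymmEquiv (n : ℕ) :
    antisymmSubmodule n ≃ₗ[ℝ] ({q : Fin n × Fin n // q.1 < q.2} → ℝ) where
  toFun A q := A.1 q.1.1 q.1.2
  map_add' A B := rfl
  map_smul' c A := rfl
  invFun f := ⟨fun i j => if h : i < j then f ⟨(i, j), h⟩ else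
      if h : j < i then -f ⟨(j, i), h⟩ else 0, by
    intro i j
    rcases lt_trichotomy i j with h | h | h
    · simp [h, not_lt.mpr h.le]
    · simp [h]
    · simp [h, not_lt.mpr h.le]⟩
  left_inv A := by
    ext i j
    have hA := A.2 i j
    rcases lt_trichotomy i j with h | h | h
    · simp [h]
    · subst h
      simp only [lt_irrefl, dite_false]
      linarith
    · simp [h, not_lt.mpr h.le, hA]
  right_inv f := by
    ext ⟨⟨i, j⟩, h⟩
    have h' : i < j := h
    simp [h']

theorem finrank_antisymmSubmodule (n : ℕ) :
    Module.finrank ℝ (antisymmSubmodule n) = n.choose 2 := by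
  rw [(antisymmEquiv n).finrank_eq, Module.finrank_fintype_fun_eq_card, Fintype.card_subtype,
    Fintype.card_product_filter_lt, Fintype.card_fin]

/-- The row sums of an antisymmetric array. -/
def rowSum (n : ℕ) : antisymmSubmodule n →ₗ[ℝ] (Fin n → ℝ) where
  toFun A i := ∑ j, A.1 i j
  map_add' A B := by
    funext i
    simp [Finset.sum_add_distrib]
  map_smul' c A := by
    funext i
    simp [Finset.mul_sum]

/-- The antisymmetric array of differences of a vector. -/
def differences (n : ℕ) : (Fin n → ℝ) →ₗ[ℝ] antisymmSubmodule n where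
  toFun x := ⟨fun i j => x i - x j, fun i j => by ring⟩
  map_add' x y := by
    ext i j
    simp
    ring
  map_smul' c x := by
    ext i j
    simp
    ring

/-- The coordinate-sum functional. -/
def coordSum (n : ℕ) : (Fin n → ℝ) →ₗ[ℝ] ℝ := ∑ i, LinearMap.proj i

theorem coordSum_apply {n : ℕ} (x : Fin n → ℝ) : coordSum n x = ∑ i, x i := by
  simp [coordSum]

theorem coordSum_rowSum {n : ℕ} (A : antisymmSubmodule n) : coordSum n (rowSum n A) = 0 := by
  rw [coordSum_apply]
  have h : ∑ i, rowSum n A i = -∑ i, rowSum n A i := by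
    change ∑ i, ∑ j, A.1 i j = -∑ i, ∑ j, A.1 i j
    conv_lhs => rw [Finset.sum_comm]
    rw [← Finset.sum_neg_distrib]
    refine Finset.sum_congr rfl fun i _ => ?_
    rw [← Finset.sum_neg_distrib]
    exact Finset.sum_congr rfl fun j _ => A.2 j i
  linarith

theorem rowSum_differences {n : ℕ} {x : Fin n → ℝ} (hx : coordSum n x = 0) :
    rowSum n (differences n x) = (n : ℝ) • x := by
  rw [coordSum_apply] at hx
  funext i
  change ∑ j, (x i - x j) = (n : ℝ) * x i
  simp [Finset.sum_sub_distrib, hx]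

theorem range_rowSum {n : ℕ} (hn : n ≠ 0) :
    LinearMap.range (rowSum n) = LinearMap.ker (coordSum n) := by
  ext x
  constructor
  · rintro ⟨A, rfl⟩
    exact coordSum_rowSum A
  · intro hx
    refine ⟨(n : ℝ)⁻¹ • differences n x, ?_⟩
    rw [map_smul, rowSum_differences hx, inv_smul_smul₀ (by exact_mod_cast hn)]

theorem finrank_ker_coordSum {n : ℕ} (hn : n ≠ 0) :
    Module.finrank ℝ (LinearMap.ker (coordSum n)) = n - 1 := by
  have h := (coordSum n).finrank_range_add_finrank_ker
  have hs : LinearMap.range (coordSum n) = ⊤ := by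
    rw [LinearMap.range_eq_top]
    intro c
    refine ⟨Pi.single ⟨0, Nat.pos_of_ne_zero hn⟩ c, ?_⟩
    simp [coordSum_apply]
  rw [hs, finrank_top, Module.finrank_self, Module.finrank_fin_fun] at h
  omega

theorem finrank_ker_rowSum {n : ℕ} (hn : n ≠ 0) :
    Module.finrank ℝ (LinearMap.ker (rowSum n)) = (n - 1) * (n - 2) / 2 := by
  have h := (rowSum n).finrank_range_add_finrank_ker
  rw [range_rowSum hn, finrank_ker_coordSum hn, finrank_antisymmSubmodule] at h
  obtain ⟨m, rfl⟩ := Nat.exists_eq_succ_of_ne_zero hn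
  have h2 : (m + 1).choose 2 = m + m.choose 2 := by
    rw [Nat.choose_succ_succ' m 1, Nat.choose_one_right]
  have h3 : (m.succ - 1) * (m.succ - 2) / 2 = m.choose 2 := (Nat.choose_two_right m).symm
  rw [h3]
  simp only [Nat.succ_eq_add_one, h2] at h ⊢
  omega

/-- The total mass and the pairwise margins of a profile. -/
def margins (n : ℕ) : (Equiv.Perm (Fin n) → ℝ) →ₗ[ℝ] ℝ × antisymmSubmodule n where
  toFun p := (∑ σ, p σ, ⟨fun i j => ∑ σ, p σ * pairSign i j σ, fun i j => by
    rw [← Finset.sum_neg_distrib]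
    refine Finset.sum_congr rfl fun σ _ => ?_
    rw [pairSign_antisymm i j]
    ring⟩)
  map_add' p q := by
    ext <;> simp [Finset.sum_add_distrib, add_mul]
  map_smul' c p := by
    ext <;> simp [Finset.mul_sum, mul_assoc]

/-- The profile scoring each ranking from a total mass and pairwise margins. -/
noncomputable def scores (n : ℕ) : ℝ × antisymmSubmodule n →ₗ[ℝ] (Equiv.Perm (Fin n) → ℝ) where
  toFun w τ := ((n : ℝ) * (n - 1) * w.1 + ∑ i, ∑ j, w.2.1 i j * pairSign i j τ) / 4
  map_add' v w := by
    funext τ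
    simp [Finset.sum_add_distrib, add_mul]
    ring
  map_smul' c w := by
    funext τ
    simp only [Prod.smul_fst, Prod.smul_snd, Submodule.coe_smul, Pi.smul_apply, smul_eq_mul,
      mul_assoc, ← Finset.mul_sum, RingHom.id_apply]
    ring

theorem kemenyOp_eq_scores_comp_margins (n : ℕ) : kemenyOp n = scores n ∘ₗ margins n := by
  refine LinearMap.ext fun p => funext fun τ => ?_
  set c : ℝ := (margins n p).1 with hc
  set A := (margins n p).2 with hA
  have hterm : ∀ i j : Fin n, (if i ≠ j then
      (∑ σ, p σ * pairIndicator n i j σ) * pairIndicator n i j τ else 0) =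
      (c * (if i = j then 0 else 1) + (c * pairSign i j τ + A.1 i j) +
        A.1 i j * pairSign i j τ) / 4 := by
    intro i j
    by_cases h : i = j
    · subst h
      have := A.2 i i
      have h0 : A.1 i i = 0 := by linarith
      simp [h0]
    · have hs : ∑ σ, p σ * pairIndicator n i j σ = (c + A.1 i j) / 2 := by
        change _ = (∑ σ, p σ + ∑ σ, p σ * pairSign i j σ) / 2
        rw [← Finset.sum_add_distrib, Finset.sum_div]
        refine Finset.sum_congr rfl fun σ _ => ?_
        rw [pairIndicator_eq, if_neg h]
        ring
      rw [hs, pairIndicator_eq, if_neg h, if_pos h]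
      ring
  have hodd : ∑ i, ∑ j, (c * pairSign i j τ + A.1 i j) = 0 := by
    have := coordSum_rowSum (⟨fun i j => c * pairSign i j τ + A.1 i j, fun i j => by
      simp only
      rw [pairSign_antisymm i j, A.2 i j]
      ring⟩ : antisymmSubmodule n)
    rwa [coordSum_apply] at this
  have hdiag : ∑ i : Fin n, ∑ j : Fin n, (c * if i = j then 0 else 1) = n * (n - 1) * c := by
    have h1 : ∀ i j : Fin n, (c * if i = j then 0 else 1) = c - if i = j then c else 0 := by
      intro i j
      split_ifs <;> simp
    simp only [h1, Finset.sum_sub_distrib]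
    simp
    ring
  change ∑ ij ∈ Finset.univ.filter (fun ij : Fin n × Fin n => ij.1 ≠ ij.2), _ =
    ((n : ℝ) * (n - 1) * c + ∑ i, ∑ j, A.1 i j * pairSign i j τ) / 4
  rw [Finset.sum_filter, Fintype.sum_prod_type]
  simp only [hterm, ← Finset.sum_div, Finset.sum_add_distrib, hdiag] at hodd ⊢
  rw [hodd]
  ring

theorem margins_scores (n : ℕ) (w : ℝ × antisymmSubmodule n) :
    margins n (scores n w) = (((n.factorial : ℝ) / 2 * (n.choose 2 : ℝ)) * w.1,
      ((n.factorial : ℝ) / 6) • (w.2 + differences n (rowSum n w.2))) := by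
  obtain ⟨c, A⟩ := w
  refine Prod.ext ?_ (Subtype.ext (funext fun k => funext fun l => ?_))
  · change ∑ σ : Equiv.Perm (Fin n),
      ((n : ℝ) * (n - 1) * c + ∑ i, ∑ j, A.1 i j * pairSign i j σ) / 4 = _
    have h0 : ∑ σ, ∑ i, ∑ j, A.1 i j * pairSign i j σ = 0 := by
      rw [Finset.sum_comm]
      refine Finset.sum_eq_zero fun i _ => ?_
      rw [Finset.sum_comm]
      refine Finset.sum_eq_zero fun j _ => ?_
      rw [← Finset.mul_sum, sum_pairSign, mul_zero]
    rw [← Finset.sum_div, Finset.sum_add_distrib, h0, Nat.cast_choose_two]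
    simp [Fintype.card_perm]
    ring
  · change ∑ σ : Equiv.Perm (Fin n),
      ((n : ℝ) * (n - 1) * c + ∑ i, ∑ j, A.1 i j * pairSign i j σ) / 4 * pairSign k l σ =
      (n.factorial : ℝ) / 6 * (A.1 k l + (∑ j, A.1 k j - ∑ j, A.1 l j))
    have hcol : ∀ m, ∑ i, A.1 i m = -∑ j, A.1 m j := fun m => by
      rw [← Finset.sum_neg_distrib]
      exact Finset.sum_congr rfl fun i _ => A.2 i m
    have h1 : ∀ σ, ((n : ℝ) * (n - 1) * c + ∑ i, ∑ j, A.1 i j * pairSign i j σ) / 4 *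
        pairSign k l σ = (n : ℝ) * (n - 1) * c / 4 * pairSign k l σ +
          (∑ i, ∑ j, A.1 i j * (pairSign i j σ * pairSign k l σ)) / 4 := by
      intro σ
      simp only [← mul_assoc, ← Finset.sum_mul]
      ring
    have h2 : ∑ σ, ∑ i, ∑ j, A.1 i j * (pairSign i j σ * pairSign k l σ) =
        ∑ i, ∑ j, A.1 i j * signGram i j k l := by
      rw [Finset.sum_comm]
      refine Finset.sum_congr rfl fun i _ => ?_
      rw [Finset.sum_comm]
      refine Finset.sum_congr rfl fun j _ => ?_
      rw [← Finset.mul_sum, signGram]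
    have h3 : ∑ i, ∑ j, A.1 i j * signGram i j k l = n.factorial / 3 *
        (∑ j, A.1 k j + ∑ i, A.1 i l - ∑ j, A.1 l j - ∑ i, A.1 i k + A.1 k l - A.1 l k) := by
      simp only [signGram_eq, mul_left_comm _ ((n.factorial : ℝ) / 3), ← Finset.mul_sum]
      congr 1
      simp only [mul_add, mul_sub, Finset.sum_add_distrib, Finset.sum_sub_distrib, mul_ite,
        mul_one, mul_zero]
      simp
    simp only [h1, Finset.sum_add_distrib, ← Finset.mul_sum, ← Finset.sum_div, sum_pairSign, h2,
      h3, hcol]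
    rw [A.2 l k]
    ring

section Spectrum

variable {n : ℕ}

theorem rowSum_add_differences_rowSum (A : antisymmSubmodule n) :
    rowSum n (A + differences n (rowSum n A)) = ((n : ℝ) + 1) • rowSum n A := by
  rw [map_add, rowSum_differences (coordSum_rowSum A), add_smul, one_smul, add_comm]

/-- Away from the eigenvalue `n + 1`, an eigenvector of `A ↦ A + differences (rowSum A)` has zero
row sums. -/
theorem rowSum_eq_zero_of_eigen {A : antisymmSubmodule n} {t : ℝ}
    (h : A + differences n (rowSum n A) = t • A) (ht : t ≠ n + 1) : rowSum n A = 0 := by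
  have h1 := rowSum_add_differences_rowSum A
  rw [h, map_smul] at h1
  have h2 : (t - (n + 1)) • rowSum n A = 0 := by rw [sub_smul, h1, sub_self]
  exact (smul_eq_zero.mp h2).resolve_left (sub_ne_zero.mpr ht)

theorem eq_zero_of_eigen {A : antisymmSubmodule n} {t : ℝ}
    (h : A + differences n (rowSum n A) = t • A) (ht : t ≠ n + 1) (ht1 : t ≠ 1) : A = 0 := by
  rw [rowSum_eq_zero_of_eigen h ht, map_zero, add_zero] at h
  have h2 : (t - 1) • A = 0 := by
    refine (sub_smul t 1 A).trans ?_
    rw [← h, one_smul, sub_self]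
  exact (smul_eq_zero.mp h2).resolve_left (sub_ne_zero.mpr ht1)

theorem mem_eigenspace_margins_comp_scores (w : ℝ × antisymmSubmodule n) (t : ℝ) :
    w ∈ Module.End.eigenspace (margins n ∘ₗ scores n) ((n.factorial : ℝ) / 6 * t) ↔
      (3 * (n.choose 2 : ℝ) - t) * w.1 = 0 ∧
        w.2 + differences n (rowSum n w.2) = t • w.2 := by
  have hf : (n.factorial : ℝ) / 6 ≠ 0 := by positivity
  rw [Module.End.mem_eigenspace_iff, LinearMap.comp_apply, margins_scores, Prod.ext_iff]
  refine and_congr ?_ ?_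
  · rw [← mul_right_inj' hf (c := 0), mul_zero, ← sub_eq_zero]
    refine Eq.congr_left ?_
    simp only [Prod.smul_fst, smul_eq_mul]
    ring
  · simp only [Prod.smul_snd, mul_smul]
    exact smul_right_inj hf

theorem injective_margins_comp_scores (hn : 3 ≤ n) :
    Function.Injective (margins n ∘ₗ scores n) := by
  rw [← LinearMap.ker_eq_bot, LinearMap.ker_eq_bot']
  intro w hw
  have hm : w ∈ Module.End.eigenspace (margins n ∘ₗ scores n) ((n.factorial : ℝ) / 6 * 0) := by
    rw [Module.End.mem_eigenspace_iff, hw, mul_zero, zero_smul]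
  obtain ⟨h1, h2⟩ := (mem_eigenspace_margins_comp_scores w 0).mp hm
  have hc : (n.choose 2 : ℝ) ≠ 0 := by exact_mod_cast (Nat.choose_pos (by omega)).ne'
  have hn1 : (0 : ℝ) ≠ n + 1 := by positivity
  refine Prod.ext ?_ (eq_zero_of_eigen h2 hn1 zero_ne_one)
  simpa [hc] using h1

theorem finrank_ker_kemenyOp (hn : 3 ≤ n) :
    Module.finrank ℝ (LinearMap.ker (kemenyOp n)) = n.factorial - (1 + n.choose 2) := by
  have hinj := injective_margins_comp_scores hn
  have hsurj : Function.Surjective (margins n ∘ₗ scores n) :=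
    LinearMap.injective_iff_surjective.mp hinj
  rw [LinearMap.coe_comp] at hinj hsurj
  have h := (margins n).finrank_range_add_finrank_ker
  rw [LinearMap.range_eq_top.mpr hsurj.of_comp, finrank_top, Module.finrank_prod,
    Module.finrank_self, finrank_antisymmSubmodule, Module.finrank_fintype_fun_eq_card,
    Fintype.card_perm, Fintype.card_fin] at h
  rw [kemenyOp_eq_scores_comp_margins, LinearMap.ker_comp_of_ker_eq_bot _
    (LinearMap.ker_eq_bot.mpr hinj.of_comp)]
  omega

theorem finrank_eigenspace_kemenyOp {t : ℝ} (ht : t ≠ 0) :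
    Module.finrank ℝ (Module.End.eigenspace (kemenyOp n) ((n.factorial : ℝ) / 6 * t)) =
      Module.finrank ℝ (Module.End.eigenspace (margins n ∘ₗ scores n)
        ((n.factorial : ℝ) / 6 * t)) := by
  rw [kemenyOp_eq_scores_comp_margins]
  exact finrank_eigenspace_comp_comm _ _ (mul_ne_zero (by positivity) ht)

theorem succ_lt_three_mul_choose_two (hn : 3 ≤ n) : (n : ℝ) + 1 < 3 * (n.choose 2 : ℝ) := by
  have h : (3 : ℝ) ≤ n := by exact_mod_cast hn
  rw [Nat.cast_choose_two]
  nlinarith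

theorem finrank_eigenspace_kemenyOp_const (hn : 3 ≤ n) :
    Module.finrank ℝ (Module.End.eigenspace (kemenyOp n)
      ((n.factorial : ℝ) / 6 * (3 * (n.choose 2 : ℝ)))) = 1 := by
  have hlt := succ_lt_three_mul_choose_two hn
  have hn0 : (0 : ℝ) ≤ n := n.cast_nonneg
  rw [finrank_eigenspace_kemenyOp (by linarith)]
  have he : Module.End.eigenspace (margins n ∘ₗ scores n)
      ((n.factorial : ℝ) / 6 * (3 * (n.choose 2 : ℝ))) =
      LinearMap.range (LinearMap.inl ℝ ℝ (antisymmSubmodule n)) := by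
    ext w
    rw [mem_eigenspace_margins_comp_scores]
    constructor
    · rintro ⟨-, h⟩
      exact ⟨w.1, Prod.ext rfl (eq_zero_of_eigen h hlt.ne' (by linarith)).symm⟩
    · rintro ⟨c, rfl⟩
      simp
  rw [he, LinearMap.finrank_range_of_inj LinearMap.inl_injective, Module.finrank_self]

theorem finrank_eigenspace_kemenyOp_differences (hn : 3 ≤ n) :
    Module.finrank ℝ (Module.End.eigenspace (kemenyOp n)
      ((n.factorial : ℝ) / 6 * (n + 1))) = n - 1 := by
  have hlt := succ_lt_three_mul_choose_two hn
  have hn0 : (n : ℝ) ≠ 0 := by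
    have : n ≠ 0 := by omega
    exact_mod_cast this
  rw [finrank_eigenspace_kemenyOp (by positivity)]
  let f := (LinearMap.inr ℝ ℝ (antisymmSubmodule n) ∘ₗ differences n).domRestrict
    (LinearMap.ker (coordSum n))
  have hf : Function.Injective f := by
    rw [← LinearMap.ker_eq_bot, LinearMap.ker_eq_bot']
    rintro ⟨x, hx⟩ h
    have h1 : differences n x = 0 := congrArg Prod.snd h
    have h2 := rowSum_differences hx
    rw [h1, map_zero] at h2
    exact Subtype.ext ((smul_eq_zero.mp h2.symm).resolve_left hn0)
  have he : Module.End.eigenspace (margins n ∘ₗ scores n) ((n.factorial : ℝ) / 6 * (n + 1)) =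
      LinearMap.range f := by
    ext w
    rw [mem_eigenspace_margins_comp_scores]
    constructor
    · rintro ⟨h1, h2⟩
      have hw : w.1 = 0 := (mul_eq_zero.mp h1).resolve_left (by linarith)
      rw [add_smul, one_smul, add_comm] at h2
      refine ⟨⟨(n : ℝ)⁻¹ • rowSum n w.2, Submodule.smul_mem _ _ (coordSum_rowSum w.2)⟩,
        Prod.ext hw.symm ?_⟩
      change differences n ((n : ℝ)⁻¹ • rowSum n w.2) = w.2
      rw [map_smul, add_right_cancel h2, inv_smul_smul₀ hn0]
    · rintro ⟨⟨x, hx⟩, rfl⟩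
      refine ⟨mul_zero _, ?_⟩
      change differences n x + differences n (rowSum n (differences n x)) =
        ((n : ℝ) + 1) • differences n x
      rw [rowSum_differences hx, map_smul, add_smul, one_smul, add_comm]
  rw [he, LinearMap.finrank_range_of_inj hf, finrank_ker_coordSum (by omega)]

theorem finrank_eigenspace_kemenyOp_rowSum (hn : 3 ≤ n) :
    Module.finrank ℝ (Module.End.eigenspace (kemenyOp n) ((n.factorial : ℝ) / 6 * 1)) =
      (n - 1) * (n - 2) / 2 := by
  have hlt := succ_lt_three_mul_choose_two hn
  have hn0 : (0 : ℝ) < n := by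
    have : 0 < n := by omega
    exact_mod_cast this
  rw [finrank_eigenspace_kemenyOp one_ne_zero]
  let f := (LinearMap.inr ℝ ℝ (antisymmSubmodule n)).domRestrict (LinearMap.ker (rowSum n))
  have hf : Function.Injective f := LinearMap.inr_injective.comp Subtype.val_injective
  have he : Module.End.eigenspace (margins n ∘ₗ scores n) ((n.factorial : ℝ) / 6 * 1) =
      LinearMap.range f := by
    ext w
    rw [mem_eigenspace_margins_comp_scores]
    constructor
    · rintro ⟨h1, h2⟩
      have hw : w.1 = 0 := (mul_eq_zero.mp h1).resolve_left (by linarith)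
      exact ⟨⟨w.2, rowSum_eq_zero_of_eigen h2 (by linarith)⟩, Prod.ext hw.symm rfl⟩
    · rintro ⟨⟨A, hA⟩, rfl⟩
      refine ⟨mul_zero _, ?_⟩
      change A + differences n (rowSum n A) = (1 : ℝ) • A
      rw [LinearMap.mem_ker.mp hA, map_zero, add_zero, one_smul]
  rw [he, LinearMap.finrank_range_of_inj hf, finrank_ker_rowSum (by omega)]

theorem finrank_eigenspace_kemenyOp_eq_zero {t : ℝ} (ht : t ≠ 0)
    (ht₀ : t ≠ 3 * (n.choose 2 : ℝ)) (ht₁ : t ≠ n + 1) (ht₂ : t ≠ 1) :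
    Module.finrank ℝ (Module.End.eigenspace (kemenyOp n) ((n.factorial : ℝ) / 6 * t)) = 0 := by
  rw [finrank_eigenspace_kemenyOp ht, Submodule.finrank_eq_zero, Submodule.eq_bot_iff]
  intro w hw
  obtain ⟨h1, h2⟩ := (mem_eigenspace_margins_comp_scores w t).mp hw
  exact Prod.ext ((mul_eq_zero.mp h1).resolve_left (sub_ne_zero.mpr ht₀.symm))
    (eq_zero_of_eigen h2 ht₁ ht₂)

theorem one_add_choose_two_lt_factorial (hn : 3 ≤ n) : 1 + n.choose 2 < n.factorial := by
  induction n, hn using Nat.le_induction with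
  | base => decide
  | succ m hm ih =>
    rw [Nat.choose_succ_succ' m 1, Nat.choose_one_right, Nat.factorial_succ]
    nlinarith

theorem kemenyOp_selfAdjoint (p q : Equiv.Perm (Fin n) → ℝ) :
    ∑ τ, kemenyOp n p τ * q τ = ∑ τ, p τ * kemenyOp n q τ := by
  simp only [kemenyOp, LinearMap.coe_mk, AddHom.coe_mk, Finset.sum_mul, Finset.mul_sum]
  rw [Finset.sum_comm]
  conv_rhs => rw [Finset.sum_comm]
  refine Finset.sum_congr rfl fun ij _ => ?_
  conv_rhs => rw [Finset.sum_comm]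
  refine Finset.sum_congr rfl fun τ _ => Finset.sum_congr rfl fun σ _ => ?_
  ring

end Spectrum

/-- For n ≥ 3, the Kemeny operator K is self-adjoint with respect to the
standard inner product, its eigenvalues are exactly κ₀ = (n!/2)·C(n,2),
κ₁ = (n+1)!/6, κ₂ = n!/6 and 0, and the corresponding eigenspaces have dimensions
1, n−1, (n−1)(n−2)/2 and n! − (n²−n+2)/2. -/
theorem kemenyOp_selfAdjoint_and_spectrum (n : ℕ) (hn : 3 ≤ n) :
    (∀ p q : Equiv.Perm (Fin n) → ℝ,
      ∑ τ : Equiv.Perm (Fin n), kemenyOp n p τ * q τ =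
        ∑ τ : Equiv.Perm (Fin n), p τ * kemenyOp n q τ)
    ∧ (∀ μ : ℝ, Module.End.HasEigenvalue (kemenyOp n) μ ↔
        (μ = (n.factorial : ℝ) / 2 * (n.choose 2 : ℝ) ∨
         μ = ((n + 1).factorial : ℝ) / 6 ∨
         μ = (n.factorial : ℝ) / 6 ∨
         μ = 0))
    ∧ Module.finrank ℝ
        (Module.End.eigenspace (kemenyOp n) ((n.factorial : ℝ) / 2 * (n.choose 2 : ℝ))) = 1
    ∧ Module.finrank ℝ
        (Module.End.eigenspace (kemenyOp n) (((n + 1).factorial : ℝ) / 6)) = n - 1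
    ∧ Module.finrank ℝ
        (Module.End.eigenspace (kemenyOp n) ((n.factorial : ℝ) / 6)) = (n - 1) * (n - 2) / 2
    ∧ Module.finrank ℝ
        (Module.End.eigenspace (kemenyOp n) (0 : ℝ)) = n.factorial - (n ^ 2 - n + 2) / 2 := by
  have e₀ : (n.factorial : ℝ) / 2 * (n.choose 2 : ℝ) =
      (n.factorial : ℝ) / 6 * (3 * (n.choose 2 : ℝ)) := by ring
  have e₁ : ((n + 1).factorial : ℝ) / 6 = (n.factorial : ℝ) / 6 * (n + 1) := by
    rw [Nat.factorial_succ]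
    push_cast
    ring
  have e₂ : (n.factorial : ℝ) / 6 = (n.factorial : ℝ) / 6 * 1 := (mul_one _).symm
  have d₀ := e₀ ▸ finrank_eigenspace_kemenyOp_const hn
  have d₁ := e₁ ▸ finrank_eigenspace_kemenyOp_differences hn
  have d₂ := finrank_eigenspace_kemenyOp_rowSum hn
  rw [← e₂] at d₂
  have d₃ : Module.finrank ℝ (Module.End.eigenspace (kemenyOp n) (0 : ℝ)) =
      n.factorial - (1 + n.choose 2) := by
    rw [Module.End.eigenspace_zero, finrank_ker_kemenyOp hn]
  have hdim : (n ^ 2 - n + 2) / 2 = 1 + n.choose 2 := by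
    rw [Nat.add_div_right _ two_pos, Nat.choose_two_right, Nat.mul_sub_one, sq, add_comm]
  refine ⟨kemenyOp_selfAdjoint, fun μ => ?_, d₀, d₁, d₂, by rw [d₃, hdim]⟩
  rw [hasEigenvalue_iff_finrank_ne_zero]
  constructor
  · intro h
    by_contra! hne
    obtain ⟨h₀, h₁, h₂, h₃⟩ := hne
    have hf : (n.factorial : ℝ) / 6 ≠ 0 := by positivity
    obtain ⟨t, rfl⟩ : ∃ t, μ = (n.factorial : ℝ) / 6 * t :=
      ⟨μ / ((n.factorial : ℝ) / 6), (mul_div_cancel₀ μ hf).symm⟩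
    refine h (finrank_eigenspace_kemenyOp_eq_zero ?_ ?_ ?_ ?_)
    · rintro rfl
      exact h₃ (mul_zero _)
    · rintro rfl
      exact h₀ e₀.symm
    · rintro rfl
      exact h₁ e₁.symm
    · rintro rfl
      exact h₂ e₂.symm
  · rintro (rfl | rfl | rfl | rfl)
    · rw [d₀]
      exact one_ne_zero
    · rw [d₁]
      omega
    · rw [d₂]
      have h : 2 * 1 ≤ (n - 1) * (n - 2) := Nat.mul_le_mul (by omega) (by omega)
      omega
    · rw [d₃]
      have := one_add_choose_two_lt_factorial hn
      omega
end

section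
/- Let n ≥ 3, let p : Perm(Fin n) → ℝ be a nonnegative profile, and suppose τ ∈ Perm(Fin n) is the unique maximizer of the Kemeny score K(p) over all rankings. Then the Borda count ranks τ's top-ranked candidate strictly above τ's bottom-ranked candidate: T_b(p)(τ(0)) > T_b(p)(τ(n−1)), where b(r) = n − 1 − r is the Borda weighting vector. -/
/-- The Kemeny score `K(p)(τ) = Σ_{(i,j), i≠j} ⟨p, a_{ij}⟩·a_{ij}(τ)`. -/
noncomputable def kemenyScore (n : ℕ) (p : Equiv.Perm (Fin n) → ℝ)
    (τ : Equiv.Perm (Fin n)) : ℝ :=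
  ∑ ij ∈ Finset.univ.filter (fun ij : Fin n × Fin n => ij.1 ≠ ij.2),
    (∑ σ : Equiv.Perm (Fin n), p σ * pairIndicator n ij.1 ij.2 σ) *
      pairIndicator n ij.1 ij.2 τ

/-- The Borda score of candidate `c` under profile `p`, with weights b(r) = n − 1 − r. -/
noncomputable def bordaScore (n : ℕ) (p : Equiv.Perm (Fin n) → ℝ) (c : Fin n) : ℝ :=
  ∑ σ : Equiv.Perm (Fin n), p σ * ((n : ℝ) - 1 - (((σ⁻¹ c) : Fin n).val : ℝ))

/-- The number of candidates below `c` minus the number above `c`, in terms of its position. -/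
theorem sum_pairIndicator_sub (n : ℕ) (σ : Equiv.Perm (Fin n)) (c : Fin n) :
    ∑ j, (pairIndicator n c j σ - pairIndicator n j c σ) =
      (n : ℝ) - 1 - 2 * ((σ⁻¹ c : Fin n).val : ℝ) := by
  unfold pairIndicator
  rw [← Equiv.sum_comp σ]
  simp only [Equiv.Perm.inv_def, Equiv.symm_apply_apply]
  rw [Finset.sum_sub_distrib, Finset.sum_boole, Finset.sum_boole,
    Finset.filter_lt_eq_Ioi, Finset.filter_gt_eq_Iio, Fin.card_Ioi, Fin.card_Iio]
  have h := (σ⁻¹ c).isLt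
  rw [Nat.sub_sub, Nat.cast_sub (by omega)]
  push_cast
  ring

/-- The total pairwise margin of a candidate is an affine function of its Borda score. -/
theorem sum_margin_eq_bordaScore (n : ℕ) (p : Equiv.Perm (Fin n) → ℝ) (c : Fin n) :
    ∑ j, ((∑ σ, p σ * pairIndicator n c j σ) - ∑ σ, p σ * pairIndicator n j c σ) =
      2 * bordaScore n p c - ((n : ℝ) - 1) * ∑ σ, p σ := by
  simp only [← Finset.sum_sub_distrib, ← mul_sub]
  rw [Finset.sum_comm]
  simp only [← Finset.mul_sum, sum_pairIndicator_sub]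
  unfold bordaScore
  rw [Finset.mul_sum, Finset.mul_sum, ← Finset.sum_sub_distrib]
  exact Finset.sum_congr rfl fun σ _ => by ring

theorem kemenyScore_eq_sum (n : ℕ) (p : Equiv.Perm (Fin n) → ℝ) (τ : Equiv.Perm (Fin n)) :
    kemenyScore n p τ =
      ∑ i, ∑ j, (∑ σ, p σ * pairIndicator n i j σ) * pairIndicator n i j τ := by
  unfold kemenyScore
  rw [← Fintype.sum_prod_type', Finset.sum_filter]
  refine Finset.sum_congr rfl fun ij _ => ?_
  split_ifs with h
  · rfl
  · rw [not_not] at h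
    simp [pairIndicator, h]

theorem Fin.add_one_lt_add_one_iff_of_ne_last {m : ℕ} {x y : Fin (m + 1)} (hx : x ≠ Fin.last m)
    (hy : y ≠ Fin.last m) : x + 1 < y + 1 ↔ x < y := by
  rw [← finRotate_apply, ← finRotate_apply,
    Fin.lt_def, Fin.lt_def, coe_finRotate_of_ne_last hx, coe_finRotate_of_ne_last hy]
  omega

/-- Moving the bottom candidate of `π` to the top changes a pairwise indicator only if the
pair involves that candidate. -/
theorem pairIndicator_rotate_sub {m : ℕ} (π : Equiv.Perm (Fin (m + 1))) (i j : Fin (m + 1)) :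
    pairIndicator (m + 1) i j (π * (finRotate (m + 1))⁻¹) - pairIndicator (m + 1) i j π =
      (if i = π (Fin.last m) then 1 else 0) - (if j = π (Fin.last m) then 1 else 0) := by
  obtain ⟨x, rfl⟩ := π.surjective i
  obtain ⟨y, rfl⟩ := π.surjective j
  have add_one_ne_zero {z : Fin (m + 1)} (hz : z ≠ Fin.last m) : z + 1 ≠ 0 := fun h => by
    rw [← finRotate_apply, Fin.ext_iff, coe_finRotate_of_ne_last hz] at h
    simp at h
  simp only [pairIndicator, mul_inv_rev, Equiv.Perm.mul_apply,
    Equiv.Perm.inv_def, Equiv.symm_apply_apply, π.injective.eq_iff]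
  by_cases hx : x = Fin.last m <;> by_cases hy : y = Fin.last m
  · simp [hx, hy]
  · subst hx
    simp [hy, add_one_ne_zero hy, (Fin.le_last y).not_gt]
  · subst hy
    simp [hx, Fin.lt_last_iff_ne_last]
  · simp [hx, hy, Fin.add_one_lt_add_one_iff_of_ne_last hx hy]

/-- Moving the bottom candidate to the top changes the Kemeny score by that candidate's total
pairwise margin. -/
theorem kemenyScore_rotate_sub {m : ℕ} (p : Equiv.Perm (Fin (m + 1)) → ℝ)
    (π : Equiv.Perm (Fin (m + 1))) :
    kemenyScore (m + 1) p (π * (finRotate (m + 1))⁻¹) - kemenyScore (m + 1) p π =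
      2 * bordaScore (m + 1) p (π (Fin.last m)) - (m : ℝ) * ∑ σ, p σ := by
  have h := sum_margin_eq_bordaScore (m + 1) p (π (Fin.last m))
  push_cast at h
  rw [add_sub_cancel_right] at h
  rw [← h, kemenyScore_eq_sum, kemenyScore_eq_sum]
  simp only [← Finset.sum_sub_distrib, ← mul_sub, pairIndicator_rotate_sub]
  simp only [mul_sub, Finset.sum_sub_distrib, mul_ite, mul_one, mul_zero]
  congr 1
  · rw [Finset.sum_comm]
    simp
  · simp

/-- If τ is the unique maximizer of the Kemeny score of a nonnegative
profile p (n ≥ 3), then the Borda count ranks τ's top candidate strictly above τ's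
bottom candidate. -/
theorem borda_separates_kemeny_winner (n : ℕ) (hn : 3 ≤ n)
    (p : Equiv.Perm (Fin n) → ℝ) (hp : ∀ σ, 0 ≤ p σ)
    (τ : Equiv.Perm (Fin n))
    (hτ : ∀ τ' : Equiv.Perm (Fin n), τ' ≠ τ → kemenyScore n p τ' < kemenyScore n p τ) :
    bordaScore n p (τ ⟨n - 1, by omega⟩) < bordaScore n p (τ ⟨0, by omega⟩) := by
  obtain ⟨m, rfl⟩ : ∃ m, n = m + 1 := ⟨n - 1, by omega⟩
  have hrot : finRotate (m + 1) ≠ 1 := fun h => by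
    have h0 := finRotate_last (n := m)
    rw [h, Equiv.Perm.one_apply, Fin.ext_iff] at h0
    simp at h0
    omega
  have hbot := kemenyScore_rotate_sub p τ
  have htop := kemenyScore_rotate_sub p (τ * finRotate (m + 1))
  rw [mul_inv_cancel_right, Equiv.Perm.mul_apply, finRotate_last] at htop
  have h1 := hτ (τ * (finRotate (m + 1))⁻¹) (by simpa using hrot)
  have h2 := hτ (τ * finRotate (m + 1)) (by simpa using hrot)
  change bordaScore (m + 1) p (τ (Fin.last m)) < bordaScore (m + 1) p (τ 0)
  linarith
end

section
/- Let n ≥ 2 and let 𝒢 be the real vector space of cooperative games on n players. The space of linear symmetric solution concepts, i.e., the subspace of linear maps φ : 𝒢 → (Fin n → ℝ) satisfying φ(σ·v)(i) = φ(v)(σ⁻¹(i)) for all σ ∈ Perm(Fin n), v ∈ 𝒢, and i ∈ Fin n, has dimension 2n − 1. -/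
/-- The space 𝒢 of cooperative games on n players: functions v : Finset (Fin n) → ℝ
with v(∅) = 0. -/
def Games (n : ℕ) : Submodule ℝ (Finset (Fin n) → ℝ) where
  carrier := {v | v ∅ = 0}
  add_mem' := by
    intro a b ha hb
    simp only [Set.mem_setOf_eq, Pi.add_apply] at *
    rw [ha, hb, add_zero]
  zero_mem' := rfl
  smul_mem' := by
    intro c v hv
    simp only [Set.mem_setOf_eq, Pi.smul_apply, smul_eq_mul] at *
    rw [hv, mul_zero]

/-- The action of a permutation σ on a game: (σ·v)(S) = v(σ⁻¹(S)). -/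
def gameAct (n : ℕ) (σ : Equiv.Perm (Fin n)) (v : Games n) : Games n :=
  ⟨fun S => (v : Finset (Fin n) → ℝ) (S.image ⇑σ⁻¹), by
    show (v : Finset (Fin n) → ℝ) (Finset.image (⇑σ⁻¹) ∅) = 0
    rw [Finset.image_empty]
    exact v.2⟩

/-- The space of linear symmetric solution concepts: linear maps φ : 𝒢 → (Fin n → ℝ)
with φ(σ·v)(i) = φ(v)(σ⁻¹ i) for all σ, v, i. -/
noncomputable def solutionConcepts (n : ℕ) : Submodule ℝ ((Games n) →ₗ[ℝ] (Fin n → ℝ)) where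
  carrier := {φ | ∀ (σ : Equiv.Perm (Fin n)) (v : Games n) (i : Fin n),
    φ (gameAct n σ v) i = φ v (σ⁻¹ i)}
  add_mem' := by
    intro φ ψ hφ hψ σ v i
    simp [hφ σ v i, hψ σ v i]
  zero_mem' := by
    intro σ v i
    simp
  smul_mem' := by
    intro a φ hφ σ v i
    simp [hφ σ v i]

/-- The game worth `1` on the coalition `S` and `0` elsewhere (the zero game if `S = ∅`). -/
def indicatorGame (n : ℕ) (S : Finset (Fin n)) : Games n :=
  ⟨fun T => if T = S ∧ T ≠ ∅ then 1 else 0, by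
    show (if (∅ : Finset (Fin n)) = S ∧ (∅ : Finset (Fin n)) ≠ ∅ then (1 : ℝ) else 0) = 0
    simp⟩

theorem indicatorGame_apply (n : ℕ) (S T : Finset (Fin n)) :
    (indicatorGame n S : Finset (Fin n) → ℝ) T = if T = S ∧ T ≠ ∅ then 1 else 0 := rfl

theorem gameAct_apply (n : ℕ) (σ : Equiv.Perm (Fin n)) (v : Games n) (S : Finset (Fin n)) :
    (gameAct n σ v : Finset (Fin n) → ℝ) S =
      (v : Finset (Fin n) → ℝ) (S.image ⇑σ⁻¹) := rfl

theorem games_eq_sum_indicatorGame (n : ℕ) (v : Games n) :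
    v = ∑ S, (v : Finset (Fin n) → ℝ) S • indicatorGame n S := by
  ext T
  have hv : (v : Finset (Fin n) → ℝ) ∅ = 0 := v.2
  simp only [Submodule.coe_sum, Submodule.coe_smul, Finset.sum_apply, Pi.smul_apply,
    indicatorGame_apply, smul_eq_mul]
  by_cases hT : T = ∅
  · simp [hT, hv]
  · simp [hT]

theorem image_perm_inv_eq_iff {α : Type*} [DecidableEq α] (σ : Equiv.Perm α) (S T : Finset α) :
    T.image ⇑σ⁻¹ = S ↔ T = S.image σ := by
  constructor <;> rintro rfl <;> ext x <;> simp [Finset.image_image]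

theorem gameAct_indicatorGame (n : ℕ) (σ : Equiv.Perm (Fin n)) (S : Finset (Fin n)) :
    gameAct n σ (indicatorGame n S) = indicatorGame n (S.image σ) := by
  ext T
  rw [gameAct_apply, indicatorGame_apply, indicatorGame_apply]
  simp only [image_perm_inv_eq_iff, ne_eq, Finset.image_eq_empty]

/-- Permutations act transitively on pointed finsets of a given cardinality and incidence. -/
theorem exists_perm_image_eq_and_apply_eq {α : Type*} [Fintype α] [DecidableEq α]
    {A B : Finset α} {a b : α} (hcard : A.card = B.card) (hab : a ∈ A ↔ b ∈ B) :
    ∃ σ : Equiv.Perm α, A.image σ = B ∧ σ a = b := by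
  let e : {x // x ∈ A} ≃ {x // x ∈ B} := Finset.equivOfCardEq hcard
  let τ : Equiv.Perm α := e.extendSubtype
  have hτ : ∀ x, τ x ∈ B ↔ x ∈ A := fun x =>
    ⟨fun h => by_contra fun hx => e.extendSubtype_not_mem x hx h,
      fun h => e.extendSubtype_mem x h⟩
  refine ⟨Equiv.swap (τ a) b * τ, ?_, by simp⟩
  have hswap : ∀ y, Equiv.swap (τ a) b y ∈ B ↔ y ∈ B := by
    intro y
    have := hτ a
    rw [Equiv.swap_apply_def]
    split_ifs with h1 h2
    · rw [h1]; tauto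
    · rw [h2]; tauto
    · rfl
  refine Finset.eq_of_subset_of_card_le ?_ ?_
  · intro y hy
    obtain ⟨x, hx, rfl⟩ := Finset.mem_image.1 hy
    exact (hswap _).2 ((hτ x).2 hx)
  · rw [Finset.card_image_of_injective _ (Equiv.injective _), hcard]

/-- A symmetric solution concept weighs `S` for player `i` through `S.card` and `i ∈ S` only. -/
theorem solutionConcepts_apply_indicatorGame_eq {n : ℕ} {φ : Games n →ₗ[ℝ] (Fin n → ℝ)}
    (hφ : φ ∈ solutionConcepts n) {A B : Finset (Fin n)} {a b : Fin n}
    (hcard : A.card = B.card) (hab : a ∈ A ↔ b ∈ B) :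
    φ (indicatorGame n A) a = φ (indicatorGame n B) b := by
  obtain ⟨σ, rfl, rfl⟩ := exists_perm_image_eq_and_apply_eq hcard hab
  have h := hφ σ (indicatorGame n A) (σ a)
  rw [gameAct_indicatorGame] at h
  simpa using h.symm

/-- The linear map giving player `i` the sum of the values `v S`, each weighted by `c S i`. -/
def weightedSolution (n : ℕ) (c : Finset (Fin n) → Fin n → ℝ) :
    Games n →ₗ[ℝ] (Fin n → ℝ) where
  toFun v i := ∑ S, (v : Finset (Fin n) → ℝ) S * c S i
  map_add' v w := by
    ext i
    simp [add_mul, Finset.sum_add_distrib]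
  map_smul' r v := by
    ext i
    simp [Finset.mul_sum, mul_assoc]

theorem weightedSolution_apply (n : ℕ) (c : Finset (Fin n) → Fin n → ℝ) (v : Games n)
    (i : Fin n) :
    weightedSolution n c v i = ∑ S, (v : Finset (Fin n) → ℝ) S * c S i := rfl

theorem weightedSolution_indicatorGame (n : ℕ) (c : Finset (Fin n) → Fin n → ℝ)
    {S : Finset (Fin n)} (hS : S ≠ ∅) (i : Fin n) :
    weightedSolution n c (indicatorGame n S) i = c S i := by
  rw [weightedSolution_apply, Finset.sum_eq_single S]
  · simp [indicatorGame_apply, hS]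
  · intro T _ hT
    simp [indicatorGame_apply, hT]
  · simp

theorem weightedSolution_mem_solutionConcepts (n : ℕ) (c : Finset (Fin n) → Fin n → ℝ)
    (hc : ∀ (σ : Equiv.Perm (Fin n)) S i, c (S.image σ) (σ i) = c S i) :
    weightedSolution n c ∈ solutionConcepts n := by
  intro σ v i
  rw [weightedSolution_apply, weightedSolution_apply]
  refine Fintype.sum_equiv σ⁻¹.finsetCongr _ _ fun S => ?_
  have hS : σ⁻¹.finsetCongr S = S.image ⇑σ⁻¹ := by
    simp [Equiv.finsetCongr_apply, Finset.map_eq_image]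
  rw [hS, gameAct_apply, hc σ⁻¹ S i]

/-- The coalition of the first `k + 1` players. -/
def initialCoalition (n k : ℕ) : Finset (Fin n) := Finset.univ.filter fun i => i.val ≤ k

theorem mem_initialCoalition {n k : ℕ} {i : Fin n} : i ∈ initialCoalition n k ↔ i.val ≤ k := by
  simp [initialCoalition]

theorem card_initialCoalition {n k : ℕ} (hk : k < n) : (initialCoalition n k).card = k + 1 := by
  have h : initialCoalition n k = Finset.Iic (⟨k, hk⟩ : Fin n) := by
    ext i
    simp [mem_initialCoalition, Fin.le_def]
  rw [h, Fin.card_Iic]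

theorem initialCoalition_ne_empty {n k : ℕ} (hk : k < n) : initialCoalition n k ≠ ∅ := by
  rw [← Finset.card_pos.trans Finset.nonempty_iff_ne_empty, card_initialCoalition hk]
  exact k.succ_pos

/-- The weights of a solution concept on initial coalitions, for the first and the last player. -/
noncomputable def initialWeights (n : ℕ) (hn : 0 < n) :
    solutionConcepts n →ₗ[ℝ] (Fin n ⊕ Fin (n - 1) → ℝ) where
  toFun φ := Sum.elim
    (fun k => φ.1 (indicatorGame n (initialCoalition n k)) ⟨0, hn⟩)
    (fun k => φ.1 (indicatorGame n (initialCoalition n k)) ⟨n - 1, by omega⟩)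
  map_add' φ ψ := by
    ext (k | k) <;> simp
  map_smul' r φ := by
    ext (k | k) <;> simp

theorem initialWeights_injective (n : ℕ) (hn : 0 < n) :
    Function.Injective (initialWeights n hn) := by
  rw [injective_iff_map_eq_zero]
  rintro ⟨φ, hφ⟩ h
  have hind : ∀ S, φ (indicatorGame n S) = 0 := by
    intro S
    ext i
    by_cases hS : S = ∅
    · have h0 : indicatorGame n S = 0 := by
        ext T
        simp +contextual [indicatorGame_apply, hS]
      simp [h0]
    have hpos : 0 < S.card := Finset.card_pos.2 (Finset.nonempty_iff_ne_empty.2 hS)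
    have hle : S.card ≤ n := by simpa using S.card_le_univ
    by_cases hi : i ∈ S
    · have hk := congrFun h (Sum.inl ⟨S.card - 1, by omega⟩)
      refine (solutionConcepts_apply_indicatorGame_eq hφ ?_ ?_).trans hk
      · exact (Nat.sub_add_cancel hpos).symm.trans (card_initialCoalition (by omega)).symm
      · simp [mem_initialCoalition, hi]
    · have hlt : S.card < n := by
        simpa using Finset.card_lt_univ_of_notMem hi
      have hk := congrFun h (Sum.inr ⟨S.card - 1, by omega⟩)
      refine (solutionConcepts_apply_indicatorGame_eq hφ ?_ ?_).trans hk
      · exact (Nat.sub_add_cancel hpos).symm.trans (card_initialCoalition (by omega)).symm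
      · simp only [mem_initialCoalition, hi, false_iff]
        omega
  ext1
  refine LinearMap.ext fun v => ?_
  rw [games_eq_sum_indicatorGame n v]
  simp [hind]

theorem initialWeights_surjective (n : ℕ) (hn : 0 < n) :
    Function.Surjective (initialWeights n hn) := by
  intro w
  let c : Finset (Fin n) → Fin n → ℝ := fun S i =>
    if i ∈ S then (if h : S.card - 1 < n then w (Sum.inl ⟨S.card - 1, h⟩) else 0)
    else (if h : S.card - 1 < n - 1 then w (Sum.inr ⟨S.card - 1, h⟩) else 0)
  have hc : ∀ (σ : Equiv.Perm (Fin n)) S i, c (S.image σ) (σ i) = c S i := by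
    intro σ S i
    simp only [c, Finset.card_image_of_injective S σ.injective,
      σ.injective.mem_finset_image]
  refine ⟨⟨weightedSolution n c, weightedSolution_mem_solutionConcepts n c hc⟩, ?_⟩
  ext (k | k)
  · have hk := k.2
    refine (weightedSolution_indicatorGame n c (initialCoalition_ne_empty hk) _).trans ?_
    simp [c, mem_initialCoalition, card_initialCoalition hk]
  · have hk := k.2
    have hk' : k.val < n := by omega
    refine (weightedSolution_indicatorGame n c (initialCoalition_ne_empty hk') _).trans ?_
    have hlast : ¬ n - 1 ≤ k.val := by omega
    simp only [c, mem_initialCoalition, card_initialCoalition hk', hlast, if_false,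
      Nat.add_sub_cancel, hk, dif_pos]

/-- For n ≥ 2, the space of linear symmetric solution concepts has
dimension 2n − 1. -/
theorem solutionConcepts_finrank (n : ℕ) (hn : 2 ≤ n) :
    Module.finrank ℝ (solutionConcepts n) = 2 * n - 1 := by
  have hn' : 0 < n := by omega
  rw [(LinearEquiv.ofBijective (initialWeights n hn')
    ⟨initialWeights_injective n hn', initialWeights_surjective n hn'⟩).finrank_eq,
    Module.finrank_fintype_fun_eq_card, Fintype.card_sum, Fintype.card_fin, Fintype.card_fin]
  omega
end

section
/- Let n ≥ 2. The 2n − 1 maps T_0^1, …, T_0^n and T_1^1, …, T_1^{n−1} are linearly independent linear symmetric solution concepts, and every linear symmetric solution concept φ : 𝒢 → (Fin n → ℝ) can be written uniquely as φ = Σ_{k=1}^{n} c_0^k T_0^k + Σ_{k=1}^{n−1} c_1^k T_1^k for real scalars c_0^k and c_1^k. -/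
/-- A(v,k): the average value over coalitions of size k. -/
noncomputable def avgVal (n : ℕ) (v : Finset (Fin n) → ℝ) (k : ℕ) : ℝ :=
  (n.choose k : ℝ)⁻¹ * ∑ S ∈ Finset.univ.filter (fun S : Finset (Fin n) => S.card = k), v S

/-- The map T_0^k: T_0^k(v)(i) = k⁻¹·A(v,k). -/
noncomputable def T0 (n k : ℕ) (v : Finset (Fin n) → ℝ) : Fin n → ℝ :=
  fun _ => (k : ℝ)⁻¹ * avgVal n v k

/-- The map T_1^k: T_1^k(v)(i) = C(n−2,k−1)⁻¹ Σ_{S : |S|=k, i ∈ S} (v(S) − A(v,k)). -/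
noncomputable def T1 (n k : ℕ) (v : Finset (Fin n) → ℝ) : Fin n → ℝ :=
  fun i => ((n - 2).choose (k - 1) : ℝ)⁻¹ *
    ∑ S ∈ Finset.univ.filter (fun S : Finset (Fin n) => S.card = k ∧ i ∈ S),
      (v S - avgVal n v k)

/-- The family of 2n − 1 maps T_0^1, …, T_0^n, T_1^1, …, T_1^{n−1}, viewed as
functions on the space 𝒢 of games. -/
noncomputable def Tfam (n : ℕ) : (Fin n ⊕ Fin (n - 1)) → (Games n → (Fin n → ℝ)) :=
  fun idx v =>
    match idx with
    | Sum.inl k => T0 n (k.val + 1) (v : Finset (Fin n) → ℝ)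
    | Sum.inr k => T1 n (k.val + 1) (v : Finset (Fin n) → ℝ)

open Finset

lemma avgVal_combination (n k : ℕ) (a b : ℝ) (v w : Finset (Fin n) → ℝ) :
    avgVal n (a • v + b • w) k = a * avgVal n v k + b * avgVal n w k := by
  simp only [avgVal, Pi.add_apply, Pi.smul_apply, smul_eq_mul, sum_add_distrib, ← mul_sum]
  ring

lemma Tfam_combination (n : ℕ) (idx : Fin n ⊕ Fin (n - 1)) (a b : ℝ) (v w : Games n) :
    Tfam n idx (a • v + b • w) = a • Tfam n idx v + b • Tfam n idx w := by
  funext i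
  rcases idx with k | k
  · simp only [Tfam, T0, Submodule.coe_add, Submodule.coe_smul, avgVal_combination, Pi.add_apply,
      Pi.smul_apply, smul_eq_mul]
    ring
  · simp only [Tfam, T1, Submodule.coe_add, Submodule.coe_smul, avgVal_combination, Pi.add_apply,
      Pi.smul_apply, smul_eq_mul, sum_add_distrib, sum_sub_distrib, ← mul_sum, sum_const,
      nsmul_eq_mul]
    ring

/-- The members of the family `Tfam`, bundled as linear maps. -/
noncomputable def TfamLin (n : ℕ) (idx : Fin n ⊕ Fin (n - 1)) : Games n →ₗ[ℝ] (Fin n → ℝ) where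
  toFun := Tfam n idx
  map_add' v w := by simpa using Tfam_combination n idx 1 1 v w
  map_smul' a v := by simpa using Tfam_combination n idx a 0 v v

lemma sum_image_perm_card {n : ℕ} (k : ℕ) (σ : Equiv.Perm (Fin n)) (f : Finset (Fin n) → ℝ) :
    ∑ S ∈ univ.filter (fun S : Finset (Fin n) => S.card = k), f (S.image ⇑σ⁻¹) =
      ∑ S ∈ univ.filter (fun S : Finset (Fin n) => S.card = k), f S := by
  refine sum_nbij' (fun S => S.image ⇑σ⁻¹) (fun S => S.image ⇑σ) ?_ ?_ ?_ ?_ ?_ <;>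
    simp [card_image_of_injective, Equiv.injective, image_image, Function.comp_def]

lemma sum_image_perm_card_mem {n : ℕ} (k : ℕ) (i : Fin n) (σ : Equiv.Perm (Fin n))
    (f : Finset (Fin n) → ℝ) :
    ∑ S ∈ univ.filter (fun S : Finset (Fin n) => S.card = k ∧ i ∈ S), f (S.image ⇑σ⁻¹) =
      ∑ S ∈ univ.filter (fun S : Finset (Fin n) => S.card = k ∧ σ⁻¹ i ∈ S), f S := by
  refine sum_nbij' (fun S => S.image ⇑σ⁻¹) (fun S => S.image ⇑σ) ?_ ?_ ?_ ?_ ?_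
  · intro S
    simp +contextual [card_image_of_injective, Equiv.injective]
  · intro S hS
    simp only [mem_filter, mem_univ, true_and] at hS ⊢
    exact ⟨by rw [card_image_of_injective _ σ.injective, hS.1],
      mem_image.2 ⟨_, hS.2, by simp⟩⟩
  all_goals simp [image_image, Function.comp_def]

lemma Tfam_symmetric (n : ℕ) (idx : Fin n ⊕ Fin (n - 1)) (σ : Equiv.Perm (Fin n)) (v : Games n)
    (i : Fin n) : Tfam n idx (gameAct n σ v) i = Tfam n idx v (σ⁻¹ i) := by
  have havg (k : ℕ) : avgVal n (gameAct n σ v : Finset (Fin n) → ℝ) k =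
      avgVal n (v : Finset (Fin n) → ℝ) k :=
    congrArg _ (sum_image_perm_card k σ _)
  rcases idx with k | k
  · simp only [Tfam, T0, havg]
  · simp only [Tfam, T1, havg]
    exact congrArg _ (sum_image_perm_card_mem _ i σ
      fun S => (v : Finset (Fin n) → ℝ) S - avgVal n (v : Finset (Fin n) → ℝ) (k.val + 1))

/-- The game that is worth `1` on the nonempty coalition `S` and `0` on every other coalition;
it is the zero game when `S` is empty. -/
noncomputable def unitGame {n : ℕ} (S : Finset (Fin n)) : Games n :=
  ⟨fun T => if T = S ∧ T ≠ ∅ then 1 else 0, by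
    show (if (∅ : Finset (Fin n)) = S ∧ (∅ : Finset (Fin n)) ≠ ∅ then (1 : ℝ) else 0) = 0
    simp⟩

lemma unitGame_apply {n : ℕ} (S T : Finset (Fin n)) :
    (unitGame S : Finset (Fin n) → ℝ) T = if T = S ∧ T ≠ ∅ then 1 else 0 := rfl

lemma unitGame_apply_of_nonempty {n : ℕ} {S : Finset (Fin n)} (hS : S.Nonempty)
    (T : Finset (Fin n)) : (unitGame S : Finset (Fin n) → ℝ) T = if T = S then 1 else 0 := by
  rw [unitGame_apply]
  exact if_congr ⟨And.left, fun h => ⟨h, h ▸ hS.ne_empty⟩⟩ rfl rfl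

lemma unitGame_empty {n : ℕ} : unitGame (∅ : Finset (Fin n)) = 0 := by
  ext T
  simp +contextual [unitGame_apply]

lemma sum_smul_unitGame {n : ℕ} (v : Games n) :
    ∑ S, (v : Finset (Fin n) → ℝ) S • unitGame S = v := by
  ext T
  have hv : (v : Finset (Fin n) → ℝ) ∅ = 0 := v.2
  by_cases hT : T = ∅
  · subst hT
    simp [unitGame_apply, hv]
  · simp [unitGame_apply, hT]

lemma gameAct_unitGame {n : ℕ} (σ : Equiv.Perm (Fin n)) (S : Finset (Fin n)) :
    gameAct n σ (unitGame S) = unitGame (S.image σ) := by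
  ext T
  have h : T.image ⇑σ⁻¹ = S ↔ T = S.image σ := by
    constructor <;> rintro rfl <;> simp [image_image, Function.comp_def]
  show (if T.image ⇑σ⁻¹ = S ∧ T.image ⇑σ⁻¹ ≠ ∅ then (1 : ℝ) else 0) = _
  simp only [unitGame_apply, h, ne_eq, image_eq_empty]

lemma linearMap_ext_unitGame {n : ℕ} {φ ψ : Games n →ₗ[ℝ] (Fin n → ℝ)}
    (h : ∀ S : Finset (Fin n), S.Nonempty → φ (unitGame S) = ψ (unitGame S)) : φ = ψ := by
  ext1 v
  rw [← sum_smul_unitGame v, map_sum, map_sum]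
  refine sum_congr rfl fun S _ => ?_
  rw [map_smul, map_smul]
  rcases S.eq_empty_or_nonempty with rfl | hS
  · simp [unitGame_empty]
  · rw [h S hS]

lemma exists_perm_image_eq {α : Type*} [Fintype α] [DecidableEq α] {S T : Finset α} {i j : α}
    (hcard : S.card = T.card) (hij : i ∈ S ↔ j ∈ T) :
    ∃ σ : Equiv.Perm α, S.image σ = T ∧ σ i = j := by
  obtain ⟨τ, hτ⟩ : ∃ τ : Equiv.Perm α, ∀ x, τ x ∈ T ↔ x ∈ S := by
    let e : {x // x ∈ S} ≃ {x // x ∈ T} := Fintype.equivOfCardEq (by simpa using hcard)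
    refine ⟨e.extendSubtype, fun x => ⟨fun hx => ?_, fun hx => e.extendSubtype_mem x hx⟩⟩
    by_contra hxS
    exact e.extendSubtype_not_mem x hxS hx
  refine ⟨τ.trans (Equiv.swap (τ i) j), eq_of_subset_of_card_le ?_ ?_, by simp⟩
  · intro y hy
    obtain ⟨x, hx, rfl⟩ := mem_image.1 hy
    have hx' := (hτ x).2 hx
    have hi := hτ i
    simp only [Equiv.trans_apply, Equiv.swap_apply_def]
    split_ifs <;> simp_all
  · rw [card_image_of_injective _ (Equiv.injective _), hcard]

lemma exists_eq_card_mem_of_symmetric {n : ℕ} (φ : Games n →ₗ[ℝ] (Fin n → ℝ))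
    (hφ : ∀ (σ : Equiv.Perm (Fin n)) (v : Games n) (i : Fin n),
      φ (gameAct n σ v) i = φ v (σ⁻¹ i)) :
    ∃ p : ℕ × Prop → ℝ, ∀ (S : Finset (Fin n)) (i : Fin n),
      φ (unitGame S) i = p (S.card, i ∈ S) := by
  have hfac : Function.FactorsThrough
      (fun x : Finset (Fin n) × Fin n => φ (unitGame x.1) x.2)
      (fun x => (x.1.card, x.2 ∈ x.1)) := by
    rintro ⟨S, i⟩ ⟨T, j⟩ h
    obtain ⟨hcard, hij⟩ := Prod.mk.inj h
    obtain ⟨σ, rfl, rfl⟩ := exists_perm_image_eq hcard hij.to_iff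
    simp [← gameAct_unitGame, hφ]
  obtain ⟨p, hp⟩ := (Function.factorsThrough_iff _).1 hfac
  exact ⟨p, fun S i => congrFun hp (S, i)⟩

lemma avgVal_unitGame {n : ℕ} {S : Finset (Fin n)} (hS : S.Nonempty) (k : ℕ) :
    avgVal n (unitGame S : Finset (Fin n) → ℝ) k =
      if S.card = k then (n.choose k : ℝ)⁻¹ else 0 := by
  simp [avgVal, unitGame_apply_of_nonempty hS]

lemma Tfam_inl_unitGame {n : ℕ} {S : Finset (Fin n)} (hS : S.Nonempty) (k : Fin n) (i : Fin n) :
    Tfam n (Sum.inl k) (unitGame S) i =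
      if S.card = k.val + 1 then ((k.val + 1 : ℕ) : ℝ)⁻¹ * (n.choose (k.val + 1) : ℝ)⁻¹ else 0 := by
  simp only [Tfam, T0, avgVal_unitGame hS, mul_ite, mul_zero]

lemma exists_card_filter_mem (n k : ℕ) : ∃ r : ℝ, ∀ i : Fin n,
    ((univ.filter (fun S : Finset (Fin n) => S.card = k ∧ i ∈ S)).card : ℝ) = r := by
  rcases isEmpty_or_nonempty (Fin n) with h | ⟨⟨j⟩⟩
  · exact ⟨0, fun i => h.elim i⟩
  · refine ⟨(univ.filter (fun S : Finset (Fin n) => S.card = k ∧ j ∈ S)).card, fun i => ?_⟩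
    simpa using sum_image_perm_card_mem k i (Equiv.swap i j) fun _ => 1

lemma exists_Tfam_inr_unitGame (n : ℕ) : ∃ r : ℕ → ℝ, ∀ (S : Finset (Fin n)), S.Nonempty →
    ∀ (k : Fin (n - 1)) (i : Fin n), Tfam n (Sum.inr k) (unitGame S) i =
      if S.card = k.val + 1 then
        ((n - 2).choose k.val : ℝ)⁻¹ * ((if i ∈ S then 1 else 0) - r k.val) else 0 := by
  choose r hr using exists_card_filter_mem n
  refine ⟨fun k => r (k + 1) * (n.choose (k + 1) : ℝ)⁻¹, fun S hS k i => ?_⟩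
  simp only [Tfam, T1, avgVal_unitGame hS, sum_sub_distrib, sum_const, nsmul_eq_mul, hr,
    unitGame_apply_of_nonempty hS,
    sum_ite_eq', mem_filter, mem_univ, true_and, Nat.add_sub_cancel]
  by_cases hc : S.card = k.val + 1 <;> simp [hc]

/-- A linear combination of the family `Tfam` on unit games, in closed form. The coefficients of
the maps `T1` are given by a function on `ℕ` vanishing at `n - 1`, which makes the formula hold
for the grand coalition too. -/
lemma exists_sum_Tfam_unitGame (n : ℕ) : ∃ r : ℕ → ℝ,
    ∀ (c : Fin n ⊕ Fin (n - 1) → ℝ) (d : ℕ → ℝ), (∀ k : Fin (n - 1), d k.val = c (Sum.inr k)) →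
      d (n - 1) = 0 → ∀ (k : Fin n) (S : Finset (Fin n)), S.card = k.val + 1 → ∀ i : Fin n,
      (∑ idx, c idx • Tfam n idx (unitGame S)) i =
        c (Sum.inl k) * (((k.val + 1 : ℕ) : ℝ)⁻¹ * (n.choose (k.val + 1) : ℝ)⁻¹) +
        d k.val * (((n - 2).choose k.val : ℝ)⁻¹ * ((if i ∈ S then 1 else 0) - r k.val)) := by
  obtain ⟨r, hr⟩ := exists_Tfam_inr_unitGame n
  refine ⟨r, fun c d hd hd' k S hS i => ?_⟩
  have hne : S.Nonempty := card_pos.1 (by omega)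
  rw [Fintype.sum_sum_type, Pi.add_apply, Finset.sum_apply, Finset.sum_apply]
  simp only [Pi.smul_apply, smul_eq_mul, Tfam_inl_unitGame hne, hr S hne, hS]
  congr 1
  · rw [sum_eq_single k]
    · simp
    · intro b _ hb
      rw [if_neg (fun h => hb (Fin.ext (by omega))), mul_zero]
    · simp
  · by_cases hk : k.val < n - 1
    · rw [sum_eq_single ⟨k.val, hk⟩]
      · simp [← hd]
      · intro b _ hb
        rw [if_neg (fun h => hb (Fin.ext (by simp; omega))), mul_zero]
      · simp
    · have hk' : k.val = n - 1 := by have := k.isLt; omega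
      rw [hk', hd', zero_mul]
      refine sum_eq_zero fun b _ => ?_
      rw [if_neg (by have := b.isLt; omega), mul_zero]

lemma exists_finset_fin_card {n m : ℕ} (h : m ≤ n) : ∃ S : Finset (Fin n), S.card = m := by
  obtain ⟨S, -, hS⟩ := exists_subset_card_eq (s := (univ : Finset (Fin n))) (n := m) (by simpa)
  exact ⟨S, hS⟩

lemma eq_zero_of_sum_Tfam_eq_zero {n : ℕ} (c : Fin n ⊕ Fin (n - 1) → ℝ)
    (hc : ∀ v : Games n, ∑ idx, c idx • Tfam n idx v = 0) : c = 0 := by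
  obtain ⟨r, hr⟩ := exists_sum_Tfam_unitGame n
  let d : ℕ → ℝ := fun k => if hk : k < n - 1 then c (Sum.inr ⟨k, hk⟩) else 0
  replace hr := hr c d (fun k => by simp [d]) (by simp [d])
  simp only [hc, Pi.zero_apply] at hr
  have hinr : ∀ k : Fin (n - 1), c (Sum.inr k) = 0 := by
    intro k
    have hk := k.isLt
    obtain ⟨S, hS⟩ := exists_finset_fin_card (n := n) (m := k.val + 1) (by omega)
    obtain ⟨i, hi⟩ : S.Nonempty := card_pos.1 (by omega)
    obtain ⟨j, hj⟩ : ∃ j, j ∉ S := by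
      by_contra! h
      have := (card_eq_iff_eq_univ S).2 (eq_univ_iff_forall.2 h)
      simp at this
      omega
    have h1 := hr ⟨k.val, by omega⟩ S hS i
    have h2 := hr ⟨k.val, by omega⟩ S hS j
    have hch : ((n - 2).choose k.val : ℝ)⁻¹ ≠ 0 :=
      inv_ne_zero (Nat.cast_ne_zero.2 (Nat.choose_pos (by omega)).ne')
    have hd : d k.val = c (Sum.inr k) := by simp [d]
    simp only [hi, hj, if_true, if_false, hd] at h1 h2
    refine (mul_eq_zero.1 (?_ : c (Sum.inr k) * ((n - 2).choose k.val : ℝ)⁻¹ = 0)).resolve_right hch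
    linear_combination h2 - h1
  have hd : ∀ k, d k = 0 := fun k => by simp [d, hinr]
  funext idx
  rcases idx with k | k
  · obtain ⟨S, hS⟩ := exists_finset_fin_card (n := n) (m := k.val + 1) k.isLt
    have h := hr k S hS k
    have hch : (n.choose (k.val + 1) : ℝ) ≠ 0 :=
      Nat.cast_ne_zero.2 (Nat.choose_pos k.isLt).ne'
    rw [hd, zero_mul, add_zero] at h
    exact (mul_eq_zero.1 h.symm).resolve_right
      (mul_ne_zero (inv_ne_zero (Nat.cast_ne_zero.2 k.val.succ_ne_zero)) (inv_ne_zero hch))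
  · exact hinr k

lemma exists_eq_sum_Tfam_of_symmetric {n : ℕ} (hn : 2 ≤ n) (φ : Games n →ₗ[ℝ] (Fin n → ℝ))
    (hφ : ∀ (σ : Equiv.Perm (Fin n)) (v : Games n) (i : Fin n),
      φ (gameAct n σ v) i = φ v (σ⁻¹ i)) :
    ∃ c : Fin n ⊕ Fin (n - 1) → ℝ, ∀ v : Games n, φ v = ∑ idx, c idx • Tfam n idx v := by
  obtain ⟨p, hp⟩ := exists_eq_card_mem_of_symmetric φ hφ
  obtain ⟨r, hr⟩ := exists_sum_Tfam_unitGame n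
  let d : ℕ → ℝ := fun k => (n - 2).choose k * (p (k + 1, True) - p (k + 1, False))
  let c : Fin n ⊕ Fin (n - 1) → ℝ := Sum.elim
    (fun k => ((k.val + 1 : ℕ) : ℝ) * n.choose (k.val + 1) *
      (p (k.val + 1, True) - d k.val * (((n - 2).choose k.val : ℝ)⁻¹ * (1 - r k.val))))
    (fun k => d k.val)
  have hd : d (n - 1) = 0 := by
    simp only [d]
    rw [Nat.choose_eq_zero_of_lt (by omega), Nat.cast_zero, zero_mul]
  refine ⟨c, fun v => ?_⟩
  suffices h : φ = ∑ idx, c idx • TfamLin n idx by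
    rw [h]
    simp [TfamLin, -Fintype.sum_sum_type]
  refine linearMap_ext_unitGame fun S hS => funext fun i => ?_
  have hpos := hS.card_pos
  have hle : S.card ≤ n := by simpa using card_le_univ S
  obtain ⟨k, hk⟩ : ∃ k : Fin n, S.card = k.val + 1 := ⟨⟨S.card - 1, by omega⟩, by simp; omega⟩
  have hsum := hr c d (fun _ => rfl) hd k S hk i
  have hgoal : (∑ idx, c idx • TfamLin n idx) (unitGame S) =
      ∑ idx, c idx • Tfam n idx (unitGame S) := by
    simp [TfamLin, -Fintype.sum_sum_type]
  have hch : (n.choose (k.val + 1) : ℝ) ≠ 0 := Nat.cast_ne_zero.2 (Nat.choose_pos k.isLt).ne'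
  have hk0 : ((k.val + 1 : ℕ) : ℝ) ≠ 0 := Nat.cast_ne_zero.2 k.val.succ_ne_zero
  have hc : c (Sum.inl k) * (((k.val + 1 : ℕ) : ℝ)⁻¹ * (n.choose (k.val + 1) : ℝ)⁻¹) =
      p (k.val + 1, True) - d k.val * (((n - 2).choose k.val : ℝ)⁻¹ * (1 - r k.val)) := by
    simp only [c, Sum.elim_inl]
    field_simp
  rw [hgoal, hsum, hp, hk, hc]
  by_cases hi : i ∈ S
  · simp [hi]
  · have hlt : S.card < n := by simpa using card_lt_univ_of_notMem hi
    have hch' : ((n - 2).choose k.val : ℝ) ≠ 0 :=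
      Nat.cast_ne_zero.2 (Nat.choose_pos (by omega)).ne'
    have hdk : d k.val * ((n - 2).choose k.val : ℝ)⁻¹ =
        p (k.val + 1, True) - p (k.val + 1, False) := by
      simp only [d]
      field_simp
    simp only [hi, if_false]
    linear_combination hdk

/-- The 2n − 1 maps T_0^1, …, T_0^n, T_1^1, …, T_1^{n−1} are linearly
independent linear symmetric solution concepts, and every linear symmetric solution
concept is uniquely a linear combination of them. -/
theorem Tfam_basis_of_solution_concepts (n : ℕ) (hn : 2 ≤ n) :
    LinearIndependent ℝ (Tfam n)
    ∧ (∀ (idx : Fin n ⊕ Fin (n - 1)) (a b : ℝ) (v w : Games n),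
        Tfam n idx (a • v + b • w) = a • Tfam n idx v + b • Tfam n idx w)
    ∧ (∀ (idx : Fin n ⊕ Fin (n - 1)) (σ : Equiv.Perm (Fin n)) (v : Games n) (i : Fin n),
        Tfam n idx (gameAct n σ v) i = Tfam n idx v (σ⁻¹ i))
    ∧ (∀ φ : (Games n) →ₗ[ℝ] (Fin n → ℝ),
        (∀ (σ : Equiv.Perm (Fin n)) (v : Games n) (i : Fin n),
          φ (gameAct n σ v) i = φ v (σ⁻¹ i)) →
        ∃! c : (Fin n ⊕ Fin (n - 1)) → ℝ,
          ∀ v : Games n, φ v = ∑ idx : Fin n ⊕ Fin (n - 1), c idx • Tfam n idx v) := by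
  refine ⟨?_, Tfam_combination n, Tfam_symmetric n, fun φ hφ => ?_⟩
  · rw [Fintype.linearIndependent_iff]
    intro g hg
    refine congrFun (eq_zero_of_sum_Tfam_eq_zero g fun v => ?_)
    simpa [-Fintype.sum_sum_type] using congrFun hg v
  · obtain ⟨c, hc⟩ := exists_eq_sum_Tfam_of_symmetric hn φ hφ
    refine ⟨c, hc, fun c' hc' => sub_eq_zero.1 (eq_zero_of_sum_Tfam_eq_zero _ fun v => ?_)⟩
    simp only [Pi.sub_apply, sub_smul, sum_sub_distrib]
    rw [← hc, ← hc', sub_self]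
end

section
/- Let n ≥ 2 and let φ = Σ_{k=1}^{n} c_0^k T_0^k + Σ_{k=1}^{n−1} c_1^k T_1^k be a linear symmetric solution concept written in terms of the maps T_0^k and T_1^k. Then φ is efficient, i.e., Σ_{i ∈ Fin n} φ(v)(i) = v(univ) for all games v, if and only if c_0^1 = c_0^2 = … = c_0^{n−1} = 0 and c_0^n = 1. -/
theorem card_filter_card_eq (n k : ℕ) :
    (Finset.univ.filter (fun S : Finset (Fin n) => S.card = k)).card = n.choose k := by
  rw [Finset.univ_filter_card_eq, Finset.card_powersetCard, Finset.card_univ, Fintype.card_fin]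

theorem sum_T0 (n k : ℕ) (v : Finset (Fin n) → ℝ) :
    ∑ i, T0 n k v i = n * ((k : ℝ)⁻¹ * avgVal n v k) := by
  simp [T0]

theorem sum_T1 {n k : ℕ} (hk : k ≤ n) (v : Finset (Fin n) → ℝ) :
    ∑ i, T1 n k v i = 0 := by
  have hc : (n.choose k : ℝ) ≠ 0 := by exact_mod_cast (Nat.choose_pos hk).ne'
  have hsum : ∑ S ∈ Finset.univ.filter (fun S : Finset (Fin n) => S.card = k),
      (v S - avgVal n v k) = 0 := by
    rw [Finset.sum_sub_distrib, Finset.sum_const, card_filter_card_eq, nsmul_eq_mul, avgVal,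
      mul_inv_cancel_left₀ hc, sub_self]
  have hswap : ∑ i, ∑ S ∈ Finset.univ.filter (fun S : Finset (Fin n) => S.card = k ∧ i ∈ S),
      (v S - avgVal n v k) =
      k * ∑ S ∈ Finset.univ.filter (fun S : Finset (Fin n) => S.card = k),
        (v S - avgVal n v k) := by
    simp_rw [← Finset.filter_filter, Finset.sum_filter (p := fun S => _ ∈ S)]
    rw [Finset.sum_comm, Finset.mul_sum]
    refine Finset.sum_congr rfl fun S hS => ?_
    rw [← (Finset.mem_filter.mp hS).2]
    simp [mul_sub]
  simp only [T1]
  rw [← Finset.mul_sum, hswap, hsum, mul_zero, mul_zero]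

theorem sum_concept (n : ℕ) (c0 c1 : ℕ → ℝ) (v : Finset (Fin n) → ℝ) :
    ∑ i : Fin n,
        (∑ k ∈ Finset.Icc 1 n, c0 k * T0 n k v i +
         ∑ k ∈ Finset.Icc 1 (n - 1), c1 k * T1 n k v i) =
      ∑ k ∈ Finset.Icc 1 n, c0 k * (n * ((k : ℝ)⁻¹ * avgVal n v k)) := by
  rw [Finset.sum_add_distrib, Finset.sum_comm, Finset.sum_comm (t := Finset.Icc 1 (n - 1))]
  simp_rw [← Finset.mul_sum, sum_T0]
  rw [add_eq_left]
  refine Finset.sum_eq_zero fun k hk => ?_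
  rw [sum_T1 ((Finset.mem_Icc.mp hk).2.trans (Nat.sub_le n 1)), mul_zero]

theorem avgVal_univ (n : ℕ) (v : Finset (Fin n) → ℝ) : avgVal n v n = v Finset.univ := by
  have h : Finset.univ.filter (fun S : Finset (Fin n) => S.card = n) = {Finset.univ} := by
    ext S
    simpa using Finset.card_eq_iff_eq_univ S
  simp [avgVal, h]

theorem avgVal_indicator_card {n j : ℕ} (hj : j ≤ n) (k : ℕ) :
    avgVal n (fun S => if S.card = j then 1 else 0) k = if k = j then 1 else 0 := by
  have hc : (n.choose j : ℝ) ≠ 0 := by exact_mod_cast (Nat.choose_pos hj).ne'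
  have h : ∀ S ∈ Finset.univ.filter (fun S : Finset (Fin n) => S.card = k),
      (if S.card = j then (1 : ℝ) else 0) = if k = j then 1 else 0 := by
    intro S hS
    rw [(Finset.mem_filter.mp hS).2]
  rw [avgVal, Finset.sum_congr rfl h, Finset.sum_const, card_filter_card_eq, nsmul_eq_mul]
  split_ifs with hkj
  · rw [hkj, mul_one, inv_mul_cancel₀ hc]
  · simp

/-- The linear symmetric solution concept
φ = Σ_{k=1}^n c_0^k T_0^k + Σ_{k=1}^{n−1} c_1^k T_1^k is efficient, i.e.
Σ_i φ(v)(i) = v(univ) for all games v, iff c_0^1 = ⋯ = c_0^{n−1} = 0 and c_0^n = 1. -/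
theorem efficient_iff_coeffs (n : ℕ) (hn : 2 ≤ n) (c0 c1 : ℕ → ℝ) :
    (∀ v : Finset (Fin n) → ℝ, v ∅ = 0 →
      ∑ i : Fin n,
        (∑ k ∈ Finset.Icc 1 n, c0 k * T0 n k v i +
         ∑ k ∈ Finset.Icc 1 (n - 1), c1 k * T1 n k v i) = v Finset.univ)
    ↔ ((∀ k ∈ Finset.Icc 1 (n - 1), c0 k = 0) ∧ c0 n = 1) := by
  have hn0 : (n : ℝ) ≠ 0 := by exact_mod_cast (by omega : n ≠ 0)
  simp_rw [sum_concept]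
  constructor
  · intro h
    have key : ∀ j ∈ Finset.Icc 1 n, c0 j * (n * (j : ℝ)⁻¹) = if n = j then 1 else 0 := by
      intro j hj
      obtain ⟨hj1, hjn⟩ := Finset.mem_Icc.mp hj
      have hv := h (fun S => if S.card = j then 1 else 0) (if_neg (by simp; omega))
      simpa [avgVal_indicator_card hjn, hj1, hjn] using hv
    constructor
    · intro k hk
      obtain ⟨hk1, hkn⟩ := Finset.mem_Icc.mp hk
      have hk0 : (k : ℝ) ≠ 0 := by exact_mod_cast (by omega : k ≠ 0)
      have hkey := key k (Finset.mem_Icc.mpr ⟨hk1, by omega⟩)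
      rw [if_neg (by omega)] at hkey
      exact (mul_eq_zero.mp hkey).resolve_right (mul_ne_zero hn0 (inv_ne_zero hk0))
    · simpa [hn0] using key n (Finset.mem_Icc.mpr ⟨by omega, le_rfl⟩)
  · rintro ⟨hzero, hone⟩ v -
    rw [Finset.sum_eq_single_of_mem n (Finset.mem_Icc.mpr ⟨by omega, le_rfl⟩), hone, one_mul,
      mul_inv_cancel_left₀ hn0, avgVal_univ]
    intro k hk hkn
    obtain ⟨hk1, hkn'⟩ := Finset.mem_Icc.mp hk
    rw [hzero k (Finset.mem_Icc.mpr ⟨hk1, by omega⟩), zero_mul]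
end

section
/- Let n ≥ 2, let m_1, …, m_n be real scalars and set m_{n+1} = 0, and let φ : 𝒢 → (Fin n → ℝ) be the marginal value φ(v)(i) = Σ_{S : i ∈ S} m_{|S|}·(v(S) − v(S \ {i})). Then φ = Σ_{k=1}^{n} c_0^k T_0^k + Σ_{k=1}^{n−1} c_1^k T_1^k, where c_0^k = k·[m_k·C(n−1,k−1) − m_{k+1}·C(n−1,k)] for 1 ≤ k ≤ n and c_1^k = C(n−2,k−1)·[m_k + m_{k+1}] for 1 ≤ k ≤ n−1. -/
/-- The marginal value with coefficients m: φ(v)(i) = Σ_{S ∋ i} m_{|S|}(v(S) − v(S\{i})). -/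
noncomputable def marginalValue (n : ℕ) (m : ℕ → ℝ) (v : Finset (Fin n) → ℝ) :
    Fin n → ℝ :=
  fun i => ∑ S ∈ Finset.univ.filter (fun S : Finset (Fin n) => i ∈ S),
    m S.card * (v S - v (S.erase i))

/-- Of the subsets of `Fin (N + 1)` of size `k ≥ 1`, exactly `N.choose (k - 1)` contain `i`. -/
theorem card_filter_card_eq_and_mem {N k : ℕ} (i : Fin (N + 1)) (hk : 1 ≤ k) :
    (Finset.univ.filter fun S : Finset (Fin (N + 1)) => S.card = k ∧ i ∈ S).card =
      N.choose (k - 1) := by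
  have hcard : (Finset.powersetCard (k - 1) (Finset.univ.erase i)).card = N.choose (k - 1) := by
    simp
  rw [← hcard]
  refine Finset.card_nbij' (fun S => S.erase i) (fun S => insert i S) ?_ ?_ ?_ ?_
  · intro S hS
    obtain ⟨hc, hi⟩ := (Finset.mem_filter.mp hS).2
    exact Finset.mem_powersetCard.mpr
      ⟨Finset.erase_subset_erase i S.subset_univ, by rw [Finset.card_erase_of_mem hi, hc]⟩
  · intro S hS
    obtain ⟨hs, hc⟩ := Finset.mem_powersetCard.mp hS
    have hi : i ∉ S := fun h => Finset.notMem_erase i _ (hs h)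
    simp only [Finset.coe_filter, Set.mem_ofPred_eq, Finset.mem_univ, true_and,
      Finset.mem_insert_self, and_true]
    rw [Finset.card_insert_of_notMem hi]
    omega
  · intro S hS
    exact Finset.insert_erase (Finset.mem_filter.mp hS).2.2
  · intro S hS
    exact Finset.erase_insert fun h =>
      Finset.notMem_erase i _ ((Finset.mem_powersetCard.mp hS).1 h)

/-- The total value of the coalitions of size `k`, split by membership of `i`. -/
theorem choose_mul_avgVal {n k : ℕ} (v : Finset (Fin n) → ℝ) (i : Fin n) (hk : k ≤ n) :
    (n.choose k : ℝ) * avgVal n v k =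
      ∑ S with S.card = k ∧ i ∈ S, v S + ∑ S with S.card = k ∧ i ∉ S, v S := by
  have hc : (n.choose k : ℝ) ≠ 0 := Nat.cast_ne_zero.mpr (Nat.choose_pos hk).ne'
  rw [avgVal, mul_inv_cancel_left₀ hc, ← Finset.sum_filter_add_sum_filter_not _ (fun S => i ∈ S),
    Finset.filter_filter, Finset.filter_filter]

/-- A sum over coalitions weighted by a function of their size, grouped by size. -/
theorem sum_filter_card_weight {n : ℕ} (p : Finset (Fin n) → Prop) [DecidablePred p]
    (w : ℕ → ℝ) (v : Finset (Fin n) → ℝ) (hv : v ∅ = 0) :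
    ∑ S with p S, w S.card * v S =
      ∑ k ∈ Finset.Icc 1 n, w k * ∑ S with S.card = k ∧ p S, v S := by
  have hmaps : ∀ S ∈ Finset.univ.filter p, S.card ∈ Finset.range (n + 1) := fun S _ =>
    Finset.mem_range_succ_iff.mpr (by simpa using S.card_le_univ)
  rw [← Finset.sum_fiberwise_of_maps_to hmaps, Finset.sum_range_succ', Finset.range_eq_Ico,
    Finset.sum_Ico_add' (fun k => ∑ S ∈ Finset.univ.filter p with S.card = k, w S.card * v S),
    zero_add, Finset.Ico_add_one_right_eq_Icc, Finset.sum_eq_zero (s := Finset.filter _ _),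
    add_zero]
  · refine Finset.sum_congr rfl fun k _ => ?_
    rw [Finset.filter_filter, Finset.mul_sum]
    refine Finset.sum_congr (Finset.filter_congr fun _ _ => and_comm) fun S hS => ?_
    rw [(Finset.mem_filter.mp hS).2.1]
  · intro S hS
    rw [Finset.card_eq_zero.mp (Finset.mem_filter.mp hS).2, hv, mul_zero]

/-- A marginal value, grouped by coalition size and by membership of the player. -/
theorem marginalValue_eq_sum_card {n : ℕ} (m : ℕ → ℝ)
    {v : Finset (Fin n) → ℝ} (hv : v ∅ = 0) (i : Fin n) :
    marginalValue n m v i =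
      ∑ k ∈ Finset.Icc 1 n, (m k * ∑ S with S.card = k ∧ i ∈ S, v S -
        m (k + 1) * ∑ S with S.card = k ∧ i ∉ S, v S) := by
  have hbij : ∑ S : Finset (Fin n) with i ∈ S, m S.card * v (S.erase i) =
      ∑ S with i ∉ S, m (S.card + 1) * v S := by
    refine Finset.sum_nbij' (fun S => S.erase i) (fun S => insert i S) ?_ ?_ ?_ ?_ ?_
    · simp
    · simp
    · intro S hS
      exact Finset.insert_erase (Finset.mem_filter.mp hS).2
    · intro S hS
      exact Finset.erase_insert (Finset.mem_filter.mp hS).2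
    · intro S hS
      rw [Finset.card_erase_add_one (Finset.mem_filter.mp hS).2]
  simp only [marginalValue, mul_sub, Finset.sum_sub_distrib]
  rw [hbij, sum_filter_card_weight _ m v hv,
    sum_filter_card_weight _ (fun k => m (k + 1)) v hv]

/-- A marginal value with coefficients m_1, …, m_n (and m_{n+1} = 0)
equals Σ_k c_0^k T_0^k + Σ_k c_1^k T_1^k with
c_0^k = k·[m_k·C(n−1,k−1) − m_{k+1}·C(n−1,k)] and c_1^k = C(n−2,k−1)·[m_k + m_{k+1}]. -/
theorem marginalValue_coeffs (n : ℕ) (hn : 2 ≤ n) (m : ℕ → ℝ) (hm : m (n + 1) = 0) :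
    ∀ v : Finset (Fin n) → ℝ, v ∅ = 0 → ∀ i : Fin n,
      marginalValue n m v i =
        ∑ k ∈ Finset.Icc 1 n,
          ((k : ℝ) * (m k * ((n - 1).choose (k - 1) : ℝ) -
            m (k + 1) * ((n - 1).choose k : ℝ))) * T0 n k v i +
        ∑ k ∈ Finset.Icc 1 (n - 1),
          (((n - 2).choose (k - 1) : ℝ) * (m k + m (k + 1))) * T1 n k v i := by
  intro v hv i
  obtain ⟨N, rfl⟩ : ∃ N, n = N + 1 := ⟨n - 1, by omega⟩
  rw [marginalValue_eq_sum_card m hv, Nat.add_sub_cancel, Finset.sum_Icc_succ_top (by omega),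
    Finset.sum_Icc_succ_top (by omega), add_right_comm (Finset.sum _ _), ← Finset.sum_add_distrib]
  congr 1
  · refine Finset.sum_congr rfl fun k hk => ?_
    obtain ⟨h1, hk⟩ := Finset.mem_Icc.mp hk
    obtain ⟨j, rfl⟩ : ∃ j, k = j + 1 := ⟨k - 1, by omega⟩
    have hk0 : ((j + 1 : ℕ) : ℝ) ≠ 0 := by positivity
    have hc : ((N + 1 - 2).choose (j + 1 - 1) : ℝ) ≠ 0 :=
      Nat.cast_ne_zero.mpr (Nat.choose_pos (by omega)).ne'
    have hsum := choose_mul_avgVal v i (show j + 1 ≤ N + 1 by omega)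
    rw [Nat.choose_succ_succ] at hsum
    simp only [T0, T1, Finset.sum_sub_distrib, Finset.sum_const, nsmul_eq_mul]
    rw [card_filter_card_eq_and_mem i h1, mul_mul_mul_comm, mul_inv_cancel₀ hk0, one_mul, mul_mul_mul_comm, mul_inv_cancel₀ hc,
      one_mul]
    simp only [Nat.add_sub_cancel]
    push_cast at hsum ⊢
    linear_combination m (j + 1 + 1) * hsum
  · have hk0 : ((N + 1 : ℕ) : ℝ) ≠ 0 := by positivity
    have hsum := choose_mul_avgVal v i (le_refl (N + 1))
    have hQ : ∑ S with S.card = N + 1 ∧ i ∉ S, v S = 0 := by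
      refine Finset.sum_eq_zero fun S hS => ?_
      obtain ⟨hcard, hi⟩ := (Finset.mem_filter.mp hS).2
      exact absurd (Finset.mem_univ i) (by rwa [(Finset.card_eq_iff_eq_univ S).mp (by simpa)] at hi)
    rw [hQ, Nat.choose_self, Nat.cast_one, one_mul, add_zero] at hsum
    simp only [T0, hm, Nat.add_sub_cancel, Nat.choose_self, hsum, hQ]
    rw [mul_mul_mul_comm, mul_inv_cancel₀ hk0]
    simp
end

section
/- Let n ≥ 2, let m_1, …, m_n be real scalars, and let φ : 𝒢 → (Fin n → ℝ) be the marginal value φ(v)(i) = Σ_{S : i ∈ S} m_{|S|}·(v(S) − v(S \ {i})). Then φ is efficient, i.e., Σ_{i} φ(v)(i) = v(univ) for all games v, if and only if m_k = (k−1)!·(n−k)!/n! for all 1 ≤ k ≤ n; in that case φ is the Shapley value. Consequently, the Shapley value is the unique efficient linear symmetric marginal value. -/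
theorem marginalValue_eq_sub (n : ℕ) (m : ℕ → ℝ) (v : Finset (Fin n) → ℝ) (i : Fin n) :
    marginalValue n m v i =
      (∑ S : Finset (Fin n), if i ∈ S then m S.card * v S else 0) -
        ∑ S : Finset (Fin n), if i ∈ S then 0 else m (S.card + 1) * v S := by
  have h : ∑ S ∈ Finset.univ.filter (fun S : Finset (Fin n) => i ∈ S),
      m S.card * v (S.erase i) =
      ∑ S ∈ Finset.univ.filter (fun S : Finset (Fin n) => i ∉ S), m (S.card + 1) * v S := by
    refine Finset.sum_bij' (fun S _ => S.erase i) (fun S _ => insert i S) ?_ ?_ ?_ ?_ ?_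
    · simp
    · simp
    · intro S hS
      exact Finset.insert_erase (by simpa using hS)
    · intro S hS
      exact Finset.erase_insert (by simpa using hS)
    · intro S hS
      rw [Finset.card_erase_add_one (by simpa using hS)]
  simp only [marginalValue, mul_sub, Finset.sum_sub_distrib, h, Finset.sum_filter, ite_not]

theorem sum_marginalValue (n : ℕ) (m : ℕ → ℝ) (v : Finset (Fin n) → ℝ) :
    ∑ i, marginalValue n m v i =
      ∑ S : Finset (Fin n), (S.card * m S.card - (n - S.card : ℝ) * m (S.card + 1)) * v S := by
  simp only [marginalValue_eq_sub, Finset.sum_sub_distrib]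
  rw [Finset.sum_comm, Finset.sum_comm (s := Finset.univ (α := Fin n)),
    ← Finset.sum_sub_distrib]
  refine Finset.sum_congr rfl fun S _ => ?_
  have h : ∑ i : Fin n, (if i ∈ S then 0 else m (S.card + 1) * v S) =
      (n - S.card : ℝ) * (m (S.card + 1) * v S) := by
    have hS : Finset.univ.filter (fun i => i ∉ S) = Sᶜ := by ext; simp
    have hle : S.card ≤ n := by simpa using S.card_le_univ
    simp_rw [← ite_not (_ ∈ S)]
    rw [← Finset.sum_filter, hS, Finset.sum_const, Finset.card_compl, Fintype.card_fin,
      nsmul_eq_mul, Nat.cast_sub hle]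
  rw [h, Finset.sum_ite_mem, Finset.univ_inter, Finset.sum_const, nsmul_eq_mul]
  ring

/-- A marginal value is efficient iff its coefficients satisfy a first-order recursion. -/
theorem efficient_marginal_iff_recursion (n : ℕ) (hn : 1 ≤ n) (m : ℕ → ℝ) :
    (∀ v : Finset (Fin n) → ℝ, v ∅ = 0 →
      ∑ i : Fin n, marginalValue n m v i = v Finset.univ)
    ↔ (n : ℝ) * m n = 1 ∧
      ∀ k, 1 ≤ k → k < n → (k : ℝ) * m k = (n - k : ℝ) * m (k + 1) := by
  simp only [sum_marginalValue]
  constructor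
  · intro h
    have key (T : Finset (Fin n)) (hT : T.Nonempty) :
        (T.card : ℝ) * m T.card - (n - T.card : ℝ) * m (T.card + 1) =
          if Finset.univ = T then 1 else 0 := by
      simpa using h (fun S => if S = T then 1 else 0) (if_neg hT.ne_empty.symm)
    refine ⟨?_, fun k hk hkn => ?_⟩
    · have := key Finset.univ (Finset.card_pos.mp (by simp; omega))
      simpa using this
    · obtain ⟨T, -, hT⟩ := Finset.exists_subset_card_eq
        (s := (Finset.univ : Finset (Fin n))) (n := k) (by simpa using hkn.le)
      have hne : Finset.univ ≠ T := by
        rintro rfl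
        simp at hT
        omega
      have := key T (Finset.card_pos.mp (by omega))
      rw [if_neg hne, hT] at this
      linarith
  · rintro ⟨hn', hrec⟩ v hv
    rw [Finset.sum_eq_single Finset.univ]
    · simp [hn']
    · intro S _ hS
      rcases S.eq_empty_or_nonempty with rfl | hne
      · simp [hv]
      · have hlt : S.card < n := by
          simpa using Finset.card_lt_card (Finset.ssubset_univ_iff.mpr hS)
        rw [hrec _ hne.card_pos hlt, sub_self, zero_mul]
    · simp

/-- A marginal value with coefficients m_1, …, m_n is efficient, i.e.
Σ_i φ(v)(i) = v(univ) for all games v, iff m_k = (k−1)!·(n−k)!/n! for 1 ≤ k ≤ n — in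
which case it is the Shapley value.  Hence the Shapley value is the unique efficient
linear symmetric marginal value. -/
theorem efficient_marginal_iff_shapley (n : ℕ) (hn : 2 ≤ n) (m : ℕ → ℝ) :
    (∀ v : Finset (Fin n) → ℝ, v ∅ = 0 →
      ∑ i : Fin n, marginalValue n m v i = v Finset.univ)
    ↔ (∀ k ∈ Finset.Icc 1 n,
        m k = ((k - 1).factorial : ℝ) * ((n - k).factorial : ℝ) / (n.factorial : ℝ)) := by
  rw [efficient_marginal_iff_recursion n (by omega) m]
  have hn0 : (n.factorial : ℝ) ≠ 0 := Nat.cast_ne_zero.mpr n.factorial_ne_zero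
  have hfac : (n : ℝ) * (n - 1).factorial = n.factorial := by
    exact_mod_cast Nat.mul_factorial_pred (by omega)
  have hstep (k : ℕ) (hk : 1 ≤ k) : (k : ℝ) * (k - 1).factorial = k.factorial := by
    exact_mod_cast Nat.mul_factorial_pred (by omega)
  have hstep' (k : ℕ) (hk : k < n) :
      (n - k : ℝ) * (n - (k + 1)).factorial = (n - k).factorial := by
    rw [← Nat.cast_sub hk.le, Nat.sub_add_eq]
    exact_mod_cast Nat.mul_factorial_pred (by omega)
  constructor
  · rintro ⟨hlast, hrec⟩ k hk
    obtain ⟨hk1, hkn⟩ := Finset.mem_Icc.mp hk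
    clear hk
    induction hkn using Nat.decreasingInduction with
    | self =>
      have hn' : (n : ℝ) ≠ 0 := by positivity
      apply mul_left_cancel₀ hn'
      rw [hlast, ← mul_div_assoc, ← mul_assoc, hfac]
      simp [hn0]
    | of_succ k hkn ih =>
      have hk' : (k : ℝ) ≠ 0 := by positivity
      apply mul_left_cancel₀ hk'
      rw [hrec k hk1 hkn, ih (by omega), Nat.add_sub_cancel, ← hstep k hk1, ← hstep' k hkn]
      ring
  · intro h
    refine ⟨?_, fun k hk hkn => ?_⟩
    · rw [h n (by simp; omega), ← mul_div_assoc, ← mul_assoc, hfac]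
      simp [hn0]
    · rw [h k (by simp; omega), h (k + 1) (by simp; omega), Nat.add_sub_cancel,
        ← hstep k hk, ← hstep' k hkn]
      ring
end

section
/- Let n ≥ 2, let m_1, …, m_n be real scalars, and let φ : 𝒢 → (Fin n → ℝ) be the marginal value φ(v)(i) = Σ_{S : i ∈ S} m_{|S|}·(v(S) − v(S \ {i})). Then φ is self-dual, i.e., φ(*v) = φ(v) for all games v where (*v)(S) = v(univ) − v(univ \ S), if and only if m_k = m_{n−k+1} for all 1 ≤ k ≤ n. -/
theorem marginalValue_dual (n : ℕ) (m : ℕ → ℝ) (v : Finset (Fin n) → ℝ) :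
    marginalValue n m (fun S => v Finset.univ - v (Finset.univ \ S)) =
      marginalValue n (fun k => m (n - k + 1)) v := by
  funext i
  unfold marginalValue
  have invol : ∀ S : Finset (Fin n), i ∈ S →
      insert i (Finset.univ \ insert i (Finset.univ \ S)) = S := by
    intro S hS
    ext j
    by_cases hj : j = i <;> simp [hj, hS]
  refine Finset.sum_nbij' (fun S => insert i (Finset.univ \ S))
    (fun S => insert i (Finset.univ \ S)) (by simp) (by simp) ?_ ?_ ?_
  · intro S hS
    exact invol S (Finset.mem_filter.mp hS).2
  · intro S hS
    exact invol S (Finset.mem_filter.mp hS).2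
  · intro S hS
    have hi : i ∈ S := (Finset.mem_filter.mp hS).2
    have hni : i ∉ Finset.univ \ S := by simp [hi]
    have hcompl : Finset.univ \ S.erase i = insert i (Finset.univ \ S) := by
      ext j
      by_cases hj : j = i <;> simp [hj]
    have hcard : n - (insert i (Finset.univ \ S)).card + 1 = S.card := by
      have hle : S.card ≤ n := by simpa using Finset.card_le_univ S
      have hpos : 0 < S.card := Finset.card_pos.mpr ⟨i, hi⟩
      rw [Finset.card_insert_of_notMem hni, Finset.card_univ_sdiff, Fintype.card_fin]
      omega
    simp only [hcard, hcompl, Finset.erase_insert hni]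
    ring

theorem marginalValue_indicator {n : ℕ} (m : ℕ → ℝ) {T : Finset (Fin n)} {i : Fin n}
    (hi : i ∈ T) :
    marginalValue n m (fun S => if S = T then 1 else 0) i = m T.card := by
  unfold marginalValue
  rw [Finset.sum_eq_single_of_mem T (by simp [hi])]
  · simp [hi]
  · intro S _ hST
    have h : S.erase i ≠ T := fun h => Finset.notMem_erase i S (h ▸ hi)
    simp [hST, h]

/-- A marginal value with coefficients m_1, …, m_n is self-dual, i.e.
φ(*v) = φ(v) for all games v where (*v)(S) = v(univ) − v(univ \ S), iff
m_k = m_{n−k+1} for all 1 ≤ k ≤ n. -/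
theorem selfDual_marginal_iff (n : ℕ) (hn : 2 ≤ n) (m : ℕ → ℝ) :
    (∀ v : Finset (Fin n) → ℝ, v ∅ = 0 →
      marginalValue n m (fun S => v Finset.univ - v (Finset.univ \ S)) =
        marginalValue n m v)
    ↔ (∀ k ∈ Finset.Icc 1 n, m k = m (n - k + 1)) := by
  constructor
  · intro h k hk
    obtain ⟨hk1, hkn⟩ := Finset.mem_Icc.mp hk
    obtain ⟨T, -, hT⟩ := Finset.exists_subset_card_eq
      (s := (Finset.univ : Finset (Fin n))) (n := k) (by simpa using hkn)
    obtain ⟨i, hi⟩ : T.Nonempty := Finset.card_pos.mp (by omega)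
    have hT0 : ∅ ≠ T := fun h0 => Finset.notMem_empty i (h0 ▸ hi)
    have key := congrFun (h (fun S => if S = T then 1 else 0) (if_neg hT0)) i
    rw [marginalValue_dual n m (fun S => if S = T then 1 else 0),
      marginalValue_indicator _ hi, marginalValue_indicator _ hi, hT] at key
    exact key.symm
  · intro h v _
    rw [marginalValue_dual]
    funext i
    unfold marginalValue
    refine Finset.sum_congr rfl fun S hS => ?_
    have hpos : 0 < S.card := Finset.card_pos.mpr ⟨i, (Finset.mem_filter.mp hS).2⟩
    have hle : S.card ≤ n := by simpa using Finset.card_le_univ S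
    rw [h S.card (Finset.mem_Icc.mpr ⟨hpos, hle⟩)]
end

section
/- Let n ≥ 2 and fix k with 1 ≤ k ≤ n − 1. Let V_k be the space of functions v from the k-element subsets of Fin n to ℝ, with the Perm(Fin n)-action (σ·v)(S) = v(σ⁻¹(S)). If φ : V_k → (Fin n → ℝ) is any linear map satisfying φ(σ·v)(i) = φ(v)(σ⁻¹(i)) for all σ, v, i, and if v ∈ V_k satisfies Σ_{S : i ∈ S, |S| = k} v(S) = 0 for every player i ∈ Fin n, then φ(v) = 0. -/
/-- The action of a permutation σ on a function v defined on k-element subsets of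
Fin n: (σ·v)(S) = v(σ⁻¹(S)). -/
def subsetAct (n k : ℕ) (σ : Equiv.Perm (Fin n))
    (v : {S : Finset (Fin n) // S.card = k} → ℝ) :
    {S : Finset (Fin n) // S.card = k} → ℝ :=
  fun S => v ⟨S.1.image ⇑σ⁻¹, by
    rw [Finset.card_image_of_injective _ (Equiv.injective σ⁻¹)]
    exact S.2⟩

theorem exists_perm_fix_image_eq {α : Type*} [Fintype α] [DecidableEq α] {S T : Finset α}
    (hcard : S.card = T.card) {i : α} (hi : i ∈ S ↔ i ∈ T) :
    ∃ σ : Equiv.Perm α, σ i = i ∧ ∀ x, σ x ∈ T ↔ x ∈ S := by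
  let e : {x // x ∈ S} ≃ {x // x ∈ T} := Finset.equivOfCardEq hcard
  have he : ∀ x, e.extendSubtype x ∈ T ↔ x ∈ S := fun x =>
    ⟨fun h => by_contra fun hx => e.extendSubtype_not_mem x hx h, e.extendSubtype_mem x⟩
  refine ⟨Equiv.swap (e.extendSubtype i) i * e.extendSubtype, by simp, fun x => ?_⟩
  have hi' := he i
  rw [← he x, Equiv.Perm.mul_apply, Equiv.swap_apply_def]
  split_ifs with h₁ h₂
  · rw [h₁, hi', hi]
  · rw [h₂, hi', hi]
  · rfl

theorem subsetAct_single {n k : ℕ} {S T : {S : Finset (Fin n) // S.card = k}}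
    {σ : Equiv.Perm (Fin n)} (hσ : ∀ x, σ x ∈ T.1 ↔ x ∈ S.1) :
    subsetAct n k σ (Pi.single S 1) = Pi.single T 1 := by
  ext U
  simp only [subsetAct, Pi.single_apply]
  congr 1
  simp only [Subtype.ext_iff, Finset.ext_iff, Finset.mem_image, eq_iff_iff]
  constructor
  · intro h x
    rw [← σ.apply_symm_apply x, hσ, ← h]
    simp
  · intro h x
    rw [← hσ, ← h]
    simp [Equiv.symm_apply_eq]

theorem equivariant_apply_single_eq {n k : ℕ}
    {φ : ({S : Finset (Fin n) // S.card = k} → ℝ) →ₗ[ℝ] (Fin n → ℝ)}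
    (hφ : ∀ (σ : Equiv.Perm (Fin n)) (v : {S : Finset (Fin n) // S.card = k} → ℝ)
      (i : Fin n), φ (subsetAct n k σ v) i = φ v (σ⁻¹ i))
    {S T : {S : Finset (Fin n) // S.card = k}} {i : Fin n} (hi : i ∈ S.1 ↔ i ∈ T.1) :
    φ (Pi.single S 1) i = φ (Pi.single T 1) i := by
  obtain ⟨σ, hσi, hσ⟩ := exists_perm_fix_image_eq (S.2.trans T.2.symm) hi
  rw [← subsetAct_single hσ, hφ, Equiv.Perm.inv_eq_iff_eq.2 hσi.symm]

theorem Finset.sum_mul_eq_zero_of_forall_eq {ι R : Type*} [NonUnitalNonAssocSemiring R]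
    {A : Finset ι} {v c : ι → R} (hc : ∀ S ∈ A, ∀ T ∈ A, c S = c T)
    (hv : ∑ S ∈ A, v S = 0) : ∑ S ∈ A, v S * c S = 0 := by
  obtain rfl | ⟨T, hT⟩ := A.eq_empty_or_nonempty
  · simp
  · rw [Finset.sum_congr rfl fun S hS => by rw [hc S hS T hT], ← Finset.sum_mul, hv, zero_mul]

theorem sum_eq_zero_of_marginals_eq_zero {n k : ℕ} (hk : k ≠ 0)
    {v : {S : Finset (Fin n) // S.card = k} → ℝ}
    (hv : ∀ i : Fin n,
      ∑ S ∈ Finset.univ.filter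
        (fun S : {S : Finset (Fin n) // S.card = k} => i ∈ S.1), v S = 0) :
    ∑ S, v S = 0 := by
  have h : ∑ i : Fin n, ∑ S : {S : Finset (Fin n) // S.card = k},
      (if i ∈ S.1 then v S else 0) = 0 :=
    Finset.sum_eq_zero fun i _ => by rw [← Finset.sum_filter, hv]
  rw [Finset.sum_comm] at h
  have h' : ∀ S : {S : Finset (Fin n) // S.card = k},
      ∑ i : Fin n, (if i ∈ S.1 then v S else 0) = k * v S := fun S => by
    simp [S.2]
  simp only [h', ← Finset.mul_sum] at h
  exact (mul_eq_zero.1 h).resolve_left (Nat.cast_ne_zero.2 hk)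

/-- For 1 ≤ k ≤ n − 1, any equivariant linear map φ : V_k → (Fin n → ℝ)
kills every v ∈ V_k all of whose "player marginals" Σ_{S ∋ i} v(S) vanish. -/
theorem equivariant_kills_higher_isotypics (n k : ℕ) (hn : 2 ≤ n)
    (hk : 1 ≤ k) (hkn : k ≤ n - 1)
    (φ : ({S : Finset (Fin n) // S.card = k} → ℝ) →ₗ[ℝ] (Fin n → ℝ))
    (hφ : ∀ (σ : Equiv.Perm (Fin n)) (v : {S : Finset (Fin n) // S.card = k} → ℝ)
      (i : Fin n), φ (subsetAct n k σ v) i = φ v (σ⁻¹ i))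
    (v : {S : Finset (Fin n) // S.card = k} → ℝ)
    (hv : ∀ i : Fin n,
      ∑ S ∈ Finset.univ.filter
        (fun S : {S : Finset (Fin n) // S.card = k} => i ∈ S.1), v S = 0) :
    φ v = 0 := by
  ext i
  rw [φ.pi_apply_eq_sum_univ v]
  have hsingle : ∀ S : {S : Finset (Fin n) // S.card = k},
      (fun T => if S = T then (1 : ℝ) else 0) = Pi.single S 1 := fun S => by
    ext T
    simp [Pi.single_apply, eq_comm]
  simp only [hsingle, Finset.sum_apply, Pi.smul_apply, smul_eq_mul, Pi.zero_apply]
  have hcompl := sum_eq_zero_of_marginals_eq_zero (Nat.one_le_iff_ne_zero.1 hk) hv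
  rw [← Finset.sum_filter_add_sum_filter_not _ (fun S => i ∈ S.1), hv i, zero_add] at hcompl
  rw [← Finset.sum_filter_add_sum_filter_not _ (fun S => i ∈ S.1),
    Finset.sum_mul_eq_zero_of_forall_eq _ (hv i),
    Finset.sum_mul_eq_zero_of_forall_eq _ hcompl, add_zero]
  all_goals
    intro S hS T hT
    rw [Finset.mem_filter_univ] at hS hT
    exact equivariant_apply_single_eq hφ (by simp only [hS, hT])
end
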